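/- arXiv:0906.0895 — 9 statements merged into one kernel-verified Lean document; each statement's English description precedes it below -/
import Mathlib

section
/- Let G be a 3-γ-vertex-critical graph of even order. If G is K_{1,5}-free, then G has a perfect matching. -/
open SimpleGraph

/-- `D` is a dominating set of `G`: every vertex is in `D` or adjacent to a vertex of `D`. -/
def IsDomSet {V : Type*} (G : SimpleGraph V) (D : Set V) : Prop :=
  ∀ v, v ∈ D ∨ ∃ u ∈ D, G.Adj u v

/-- The domination number `γ(G)`. -/
noncomputable def domNum {V : Type*} (G : SimpleGraph V) : ℕ :=
  sInf {n | ∃ D : Set V, IsDomSet G D ∧ D.ncard = n}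

/-- `D` is a dominating set of the vertex-deleted graph `G - x`. -/
def IsDomSetAvoiding {V : Type*} (G : SimpleGraph V) (x : V) (D : Set V) : Prop :=
  x ∉ D ∧ ∀ v, v ≠ x → v ∈ D ∨ ∃ u ∈ D, G.Adj u v

/-- The domination number of the vertex-deleted graph `G - x`. -/
noncomputable def domNumDel {V : Type*} (G : SimpleGraph V) (x : V) : ℕ :=
  sInf {n | ∃ D : Set V, IsDomSetAvoiding G x D ∧ D.ncard = n}

/-- `G` is `k`-`γ`-vertex-critical: `γ(G) = k` and `γ(G - v) < k` for every vertex `v`. -/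
def GammaCritical {V : Type*} (G : SimpleGraph V) (k : ℕ) : Prop :=
  domNum G = k ∧ ∀ v : V, domNumDel G v < k

/-- `G` is `K_{1,n}`-free: it has no induced subgraph isomorphic to the star `K_{1,n}`. -/
def StarFree {V : Type*} (G : SimpleGraph V) (n : ℕ) : Prop :=
  ¬ ∃ (c : V) (T : Finset V), T.card = n ∧ (∀ t ∈ T, G.Adj c t) ∧
      ∀ t ∈ T, ∀ t' ∈ T, t ≠ t' → ¬ G.Adj t t'

/-- `G` has a perfect matching. -/
def HasPerfectMatching {V : Type*} (G : SimpleGraph V) : Prop :=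
  ∃ M : G.Subgraph, M.IsPerfectMatching

/-- `G` has a near perfect matching: a matching covering all but exactly one vertex. -/
def HasNearPerfectMatching {V : Type*} (G : SimpleGraph V) : Prop :=
  ∃ (M : G.Subgraph) (v : V), M.IsMatching ∧ M.verts = {v}ᶜ

/-- `c_o(G - S)`: the number of odd components of `G - S`. -/
noncomputable def numOddComponents {V : Type*} (G : SimpleGraph V) (S : Set V) : ℕ :=
  Nat.card {c : (G.induce Sᶜ).ConnectedComponent // Odd c.supp.ncard}

/-- The pair `{x, y}` dominates every vertex of `G` except `v`. -/
structure DominatesAllBut {V : Type*} (G : SimpleGraph V) (v x y : V) : Prop where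
  ne : x ≠ y
  ne_left : x ≠ v
  ne_right : y ≠ v
  not_adj_left : ¬ G.Adj x v
  not_adj_right : ¬ G.Adj y v
  dom : ∀ w, w ≠ v → w = x ∨ w = y ∨ G.Adj x w ∨ G.Adj y w

namespace DominatesAllBut

variable {V : Type*} {G : SimpleGraph V} {v w x y : V}

theorem symm (h : DominatesAllBut G v x y) : DominatesAllBut G v y x :=
  ⟨h.ne.symm, h.ne_right, h.ne_left, h.not_adj_right, h.not_adj_left,
    fun w hw => by have := h.dom w hw; tauto⟩

theorem unique (h : DominatesAllBut G v x y) (h' : DominatesAllBut G w x y) : v = w := by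
  by_contra hvw
  rcases h'.dom v hvw with e | e | e | e
  · exact h.ne_left e.symm
  · exact h.ne_right e.symm
  · exact h.not_adj_left e
  · exact h.not_adj_right e

end DominatesAllBut

section Critical

variable {V : Type*} [Fintype V] {G : SimpleGraph V}

theorem GammaCritical.exists_not_dominated (h : GammaCritical G 3) (x y : V) :
    ∃ v, v ≠ x ∧ v ≠ y ∧ ¬ G.Adj x v ∧ ¬ G.Adj y v := by
  classical
  by_contra! hc
  have hD : IsDomSet G {x, y} := by
    intro v
    by_cases h1 : v = x
    · simp [h1]
    by_cases h2 : v = y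
    · simp [h2]
    by_cases h3 : G.Adj x v
    · exact Or.inr ⟨x, by simp, h3⟩
    · exact Or.inr ⟨y, by simp, hc v h1 h2 h3⟩
  have h1 : domNum G ≤ ({x, y} : Set V).ncard := Nat.sInf_le ⟨_, hD, rfl⟩
  have h2 := Set.ncard_insert_le x {y}
  rw [Set.ncard_singleton] at h2
  have := h.1
  lia

theorem GammaCritical.exists_dominatesAllBut (h : GammaCritical G 3) (v : V) :
    ∃ x y, DominatesAllBut G v x y := by
  classical
  have hne : {n | ∃ D : Set V, IsDomSetAvoiding G v D ∧ D.ncard = n}.Nonempty :=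
    ⟨_, {v}ᶜ, ⟨by simp, fun w hw => Or.inl (by simpa using hw)⟩, rfl⟩
  obtain ⟨D, ⟨hvD, hD⟩, hcard⟩ := Nat.sInf_mem hne
  have hlt : D.ncard < 3 := by rw [hcard]; exact h.2 v
  obtain ⟨x, y, hDxy⟩ : ∃ x y, D ⊆ {x, y} ∧ (x = v ∨ x ∈ D) ∧ (y = v ∨ y ∈ D) := by
    interval_cases hn : D.ncard
    · rw [Set.ncard_eq_zero] at hn
      exact ⟨v, v, by simp [hn]⟩
    · obtain ⟨a, rfl⟩ := Set.ncard_eq_one.1 hn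
      exact ⟨a, v, by simp⟩
    · obtain ⟨a, b, -, rfl⟩ := Set.ncard_eq_two.1 hn
      exact ⟨a, b, by simp⟩
  obtain ⟨hsub, hx, hy⟩ := hDxy
  have key : ∀ w, w ≠ v → w = x ∨ w = y ∨ G.Adj x w ∨ G.Adj y w := by
    intro w hw
    rcases hD w hw with h1 | ⟨u, hu, h1⟩
    · rcases hsub h1 with h2 | h2
      · exact Or.inl h2
      · exact Or.inr (Or.inl h2)
    · rcases hsub hu with h2 | h2
      · exact Or.inr (Or.inr (Or.inl (h2 ▸ h1)))
      · exact Or.inr (Or.inr (Or.inr (h2 ▸ h1)))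
  have hx' : x ≠ v := by
    rintro rfl
    obtain ⟨w, h1, h2, h3, h4⟩ := h.exists_not_dominated x y
    have := key w h1
    tauto
  have hy' : y ≠ v := by
    rintro rfl
    obtain ⟨w, h1, h2, h3, h4⟩ := h.exists_not_dominated x y
    have := key w h2
    tauto
  obtain ⟨u, h1, h2, h3, h4⟩ := h.exists_not_dominated x y
  have huv : u = v := by
    by_contra huv
    have := key u huv
    tauto
  subst huv
  refine ⟨x, y, ?_, hx', hy', h3, h4, key⟩
  rintro rfl
  obtain ⟨w, k1, k2, k3, k4⟩ := h.exists_not_dominated x u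
  have := key w k2
  tauto

end Critical

/-- A finite set of vertices such that for each `v` in it some other vertex of the set is
adjacent to everything in the set but `v` has an even number of elements. -/
theorem even_card_of_forall_exists_unique_nonadj {V : Type*} (G : SimpleGraph V) (W : Finset V)
    (h : ∀ v ∈ W, ∃ x ∈ W, x ≠ v ∧ ¬ G.Adj x v ∧ ∀ w ∈ W, w ≠ v → w = x ∨ G.Adj x w) :
    Even W.card := by
  classical
  choose f hfW hne hna hdom using h
  have hinv : ∀ v (hv : v ∈ W), f (f v hv) (hfW v hv) = v := by
    have hinj : Function.Injective (fun v : W => (⟨f v v.2, hfW v v.2⟩ : W)) := by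
      rintro ⟨v, hv⟩ ⟨v', hv'⟩ hvv
      simp only [Subtype.mk.injEq] at hvv ⊢
      by_contra hn
      rcases hdom v hv v' hv' (Ne.symm hn) with e | e
      · exact hne v' hv' (by rw [← hvv, ← e])
      · exact hna v' hv' (hvv ▸ e)
    have hsurj := Finite.surjective_of_injective hinj
    intro v hv
    obtain ⟨⟨u, hu⟩, e⟩ := hsurj ⟨v, hv⟩
    simp only [Subtype.mk.injEq] at e
    have huf : f v hv = u := by
      by_contra hn
      rcases hdom u hu (f v hv) (hfW v hv) hn with e' | e'
      · exact hne v hv (e'.trans e)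
      · exact hna v hv (e ▸ e'.symm)
    simp only [huf, e]
  have hsum : ∑ _v ∈ W, (1 : ZMod 2) = 0 :=
    Finset.sum_involution f (fun _ _ => by decide) (fun v hv _ => hne v hv) hfW hinv
  rw [Finset.sum_const, nsmul_one] at hsum
  exact (ZMod.natCast_eq_zero_iff_even).1 hsum

/-- `c` labels the vertices outside `S` by (unions of) components of `G - S`. -/
structure IsSeparation {V ι : Type*} (G : SimpleGraph V) (S : Finset V) (c : V → ι) : Prop where
  label_eq : ∀ ⦃v w⦄, v ∉ S → w ∉ S → G.Adj v w → c v = c w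
  exists_label : ∀ i, ∃ v ∉ S, c v = i

/-- A vertex `x ∈ S` of a pair dominating `G - v` is adjacent to every vertex outside `S` whose label
is neither that of `v` nor that of the other vertex of the pair. -/
theorem IsSeparation.adj_of_dominatesAllBut {V ι : Type*} {G : SimpleGraph V} {S : Finset V}
    {c : V → ι} {v w x y : V} (hc : IsSeparation G S c) (hd : DominatesAllBut G v x y)
    (hx : x ∈ S) (hy : y ∉ S) (hw : w ∉ S) (hwv : w ≠ v) (hwy : c w ≠ c y) : G.Adj x w := by
  rcases hd.dom w hwv with h | h | h | h
  · exact absurd (h ▸ hx) hw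
  · exact absurd (by rw [h]) hwy
  · exact h
  · exact absurd (hc.label_eq hy hw h).symm hwy

section Labels

variable {V ι : Type*} [Fintype ι] {G : SimpleGraph V} {S : Finset V} {c : V → ι}
  {v w x y : V}

open Classical in
/-- The labels of the vertices outside `S` that are dominated by `p`. -/
noncomputable def dominatedLabels (G : SimpleGraph V) (S : Finset V) (c : V → ι) (p : V) :
    Finset ι :=
  Finset.univ.filter fun i => ∃ v ∉ S, c v = i ∧ (v = p ∨ G.Adj p v)

namespace IsSeparation

theorem card_dominatedLabels_of_notMem (hc : IsSeparation G S c) (hx : x ∉ S) :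
    (dominatedLabels G S c x).card ≤ 1 := by
  rw [Finset.card_le_one]
  have key : ∀ i ∈ dominatedLabels G S c x, i = c x := by
    intro i hi
    simp only [dominatedLabels, Finset.mem_filter, Finset.mem_univ, true_and] at hi
    obtain ⟨v, hv, rfl, rfl | h⟩ := hi
    · rfl
    · exact (hc.label_eq hx hv h).symm
  intro i hi j hj
  rw [key i hi, key j hj]

theorem card_dominatedLabels_le_four (hc : IsSeparation G S c) (hfree : StarFree G 5) (p : V) :
    (dominatedLabels G S c p).card ≤ 4 := by
  classical
  by_cases hp : p ∈ S
  swap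
  · exact (hc.card_dominatedLabels_of_notMem hp).trans (by norm_num)
  by_contra! h
  obtain ⟨A, hA, hA5⟩ := Finset.exists_subset_card_eq (show 5 ≤ _ from h)
  have hrep : ∀ i ∈ A, ∃ v ∉ S, c v = i ∧ G.Adj p v := by
    intro i hi
    have hi := hA hi
    simp only [dominatedLabels, Finset.mem_filter, Finset.mem_univ, true_and] at hi
    obtain ⟨v, hv, h1, rfl | h2⟩ := hi
    · exact absurd hp hv
    · exact ⟨v, hv, h1, h2⟩
  have : Nonempty V := ⟨p⟩
  choose! r hrS hrc hradj using hrep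
  refine hfree ⟨p, A.image r, ?_, ?_, ?_⟩
  · rw [Finset.card_image_of_injOn, hA5]
    intro i hi j hj hij
    rw [← hrc i hi, ← hrc j hj, hij]
  · intro t ht
    obtain ⟨i, hi, rfl⟩ := Finset.mem_image.1 ht
    exact hradj i hi
  · intro t ht t' ht' hne hadj
    obtain ⟨i, hi, rfl⟩ := Finset.mem_image.1 ht
    obtain ⟨j, hj, rfl⟩ := Finset.mem_image.1 ht'
    have := hc.label_eq (hrS i hi) (hrS j hj) hadj
    rw [hrc i hi, hrc j hj] at this
    exact hne (by rw [this])

theorem label_mem_union [DecidableEq ι] (hd : DominatesAllBut G v x y) (hw : w ∉ S) (hwv : w ≠ v) :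
    c w ∈ dominatedLabels G S c x ∪ dominatedLabels G S c y := by
  simp only [dominatedLabels, Finset.mem_union, Finset.mem_filter, Finset.mem_univ, true_and]
  rcases hd.dom w hwv with h | h | h | h
  · exact Or.inl ⟨w, hw, rfl, Or.inl h⟩
  · exact Or.inr ⟨w, hw, rfl, Or.inl h⟩
  · exact Or.inl ⟨w, hw, rfl, Or.inr h⟩
  · exact Or.inr ⟨w, hw, rfl, Or.inr h⟩

theorem card_union_of_mem [DecidableEq ι] (hc : IsSeparation G S c) (hd : DominatesAllBut G v x y)
    (hv : v ∈ S) :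
    Fintype.card ι ≤ (dominatedLabels G S c x ∪ dominatedLabels G S c y).card := by
  rw [← Finset.card_univ]
  refine Finset.card_le_card fun i _ => ?_
  obtain ⟨w, hw, rfl⟩ := hc.exists_label i
  exact label_mem_union hd hw fun e => hw (e ▸ hv)

theorem card_union [DecidableEq ι] (hc : IsSeparation G S c) (hd : DominatesAllBut G v x y) :
    Fintype.card ι ≤ (dominatedLabels G S c x ∪ dominatedLabels G S c y).card + 1 := by
  rw [← Finset.card_univ]
  refine (Finset.card_le_card (t := insert (c v) _) fun i _ => ?_).trans
    (Finset.card_insert_le _ _)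
  obtain ⟨w, hw, rfl⟩ := hc.exists_label i
  by_cases e : w = v
  · simp [e]
  · exact Finset.mem_insert_of_mem (label_mem_union hd hw e)

theorem card_le_add_of_mem (hc : IsSeparation G S c) (hd : DominatesAllBut G v x y) (hv : v ∈ S) :
    Fintype.card ι ≤ (dominatedLabels G S c x).card + (dominatedLabels G S c y).card := by
  classical
  exact (hc.card_union_of_mem hd hv).trans (Finset.card_union_le _ _)

theorem card_le_add (hc : IsSeparation G S c) (hd : DominatesAllBut G v x y) :
    Fintype.card ι ≤ (dominatedLabels G S c x).card + (dominatedLabels G S c y).card + 1 := by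
  classical
  exact (hc.card_union hd).trans (Nat.add_le_add_right (Finset.card_union_le _ _) 1)

theorem mem_or_mem_of_mem (hc : IsSeparation G S c) (ht : 3 ≤ Fintype.card ι)
    (hd : DominatesAllBut G v x y) (hv : v ∈ S) : x ∈ S ∨ y ∈ S := by
  by_contra! h
  have h1 := hc.card_dominatedLabels_of_notMem h.1
  have h2 := hc.card_dominatedLabels_of_notMem h.2
  have := hc.card_le_add_of_mem hd hv
  lia

theorem mem_or_mem (hc : IsSeparation G S c) (ht : 4 ≤ Fintype.card ι)
    (hd : DominatesAllBut G v x y) : x ∈ S ∨ y ∈ S := by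
  by_contra! h
  have h1 := hc.card_dominatedLabels_of_notMem h.1
  have h2 := hc.card_dominatedLabels_of_notMem h.2
  have := hc.card_le_add hd
  lia

theorem mem_and_mem_of_mem (hc : IsSeparation G S c) (hfree : StarFree G 5)
    (ht : 6 ≤ Fintype.card ι) (hd : DominatesAllBut G v x y) (hv : v ∈ S) : x ∈ S ∧ y ∈ S := by
  have h := hc.card_le_add_of_mem hd hv
  have h1 := hc.card_dominatedLabels_le_four hfree x
  have h2 := hc.card_dominatedLabels_le_four hfree y
  constructor
  · by_contra hx
    have := hc.card_dominatedLabels_of_notMem hx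
    lia
  · by_contra hx
    have := hc.card_dominatedLabels_of_notMem hx
    lia

theorem mem_and_mem (hc : IsSeparation G S c) (hfree : StarFree G 5)
    (ht : 7 ≤ Fintype.card ι) (hd : DominatesAllBut G v x y) : x ∈ S ∧ y ∈ S := by
  have h := hc.card_le_add hd
  have h1 := hc.card_dominatedLabels_le_four hfree x
  have h2 := hc.card_dominatedLabels_le_four hfree y
  constructor
  · by_contra hx
    have := hc.card_dominatedLabels_of_notMem hx
    lia
  · by_contra hx
    have := hc.card_dominatedLabels_of_notMem hx
    lia

theorem exists_not_adj (hc : IsSeparation G S c) (ht : 4 ≤ Fintype.card ι)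
    (hD : ∀ v, ∃ x y, DominatesAllBut G v x y) (v : V) : ∃ p ∈ S, ¬ G.Adj p v := by
  obtain ⟨x, y, hd⟩ := hD v
  rcases hc.mem_or_mem ht hd with h | h
  · exact ⟨x, h, hd.not_adj_left⟩
  · exact ⟨y, h, hd.not_adj_right⟩

theorem exists_dominatesAllBut_mem (hc : IsSeparation G S c) (ht : 4 ≤ Fintype.card ι)
    (hD : ∀ v, ∃ x y, DominatesAllBut G v x y) (v : V) :
    ∃ x y, DominatesAllBut G v x y ∧ x ∈ S := by
  obtain ⟨x, y, hd⟩ := hD v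
  rcases hc.mem_or_mem ht hd with h | h
  · exact ⟨x, y, hd, h⟩
  · exact ⟨y, x, hd.symm, h⟩

theorem two_mul_card_add_two_le [Fintype V] (hc : IsSeparation G S c)
    (ht : S.card + 2 ≤ Fintype.card ι) : 2 * S.card + 2 ≤ Fintype.card V := by
  classical
  choose r hrS hrc using hc.exists_label
  have hinj : Function.Injective r := fun i j e => by rw [← hrc i, ← hrc j, e]
  have hsub : Finset.univ.image r ⊆ Sᶜ := by
    intro v hv
    obtain ⟨i, -, rfl⟩ := Finset.mem_image.1 hv
    simpa using hrS i
  have h := Finset.card_le_card hsub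
  rw [Finset.card_image_of_injective _ hinj, Finset.card_univ, Finset.card_compl] at h
  lia

theorem false_of_card_one (hc : IsSeparation G S c) (hD : ∀ v, ∃ x y, DominatesAllBut G v x y)
    (ht : 3 ≤ Fintype.card ι) (hS : S.card = 1) : False := by
  obtain ⟨u, rfl⟩ := Finset.card_eq_one.1 hS
  obtain ⟨x, y, hd⟩ := hD u
  have := hc.mem_or_mem_of_mem ht hd (by simp)
  simp only [Finset.mem_singleton] at this
  exact this.elim hd.ne_left hd.ne_right

theorem false_of_card_two (hc : IsSeparation G S c) (hD : ∀ v, ∃ x y, DominatesAllBut G v x y)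
    (ht : 4 ≤ Fintype.card ι) (hS : S.card = 2) : False := by
  classical
  obtain ⟨u, w, huw, rfl⟩ := Finset.card_eq_two.1 hS
  have key : ∀ p q, p ∈ ({u, w} : Finset V) → (∀ z ∈ ({u, w} : Finset V), z = p ∨ z = q) →
      ∃ i, ∀ z ∉ ({u, w} : Finset V), c z ≠ i → G.Adj q z := by
    intro p q hp hpq
    obtain ⟨x, y, hd, hx⟩ := hc.exists_dominatesAllBut_mem ht hD p
    have hxq := (hpq x hx).resolve_left hd.ne_left
    subst hxq
    have hy : y ∉ ({u, w} : Finset V) := fun hy =>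
      (hpq y hy).elim hd.ne_right hd.ne.symm
    exact ⟨c y, fun z hz hzy => hc.adj_of_dominatesAllBut hd hx hy hz (fun e => hz (e ▸ hp)) hzy⟩
  obtain ⟨i, hi⟩ := key u w (by simp) (by simp)
  obtain ⟨j, hj⟩ := key w u (by simp) (by simp)
  obtain ⟨k, hk⟩ : ∃ k, k ∉ ({i, j} : Finset ι) := by
    by_contra! h
    have h1 := Finset.card_le_card (fun k (_ : k ∈ Finset.univ) => h k)
    have h2 := Finset.card_le_two (a := i) (b := j)
    rw [Finset.card_univ] at h1
    lia
  simp only [Finset.mem_insert, Finset.mem_singleton, not_or] at hk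
  obtain ⟨z, hz, rfl⟩ := hc.exists_label k
  obtain ⟨p, hp, hpz⟩ := hc.exists_not_adj ht hD z
  rcases Finset.mem_insert.1 hp with rfl | hp
  · exact hpz (hj z hz hk.2)
  · rw [Finset.mem_singleton] at hp
    subst hp
    exact hpz (hi z hz hk.1)

open Classical in
theorem even_card_not_adj [Fintype V] (hc : IsSeparation G S c)
    (hD : ∀ v, ∃ x y, DominatesAllBut G v x y) (ht : 4 ≤ Fintype.card ι) {a b d : V}
    (hS : ∀ p, p ∈ S ↔ p = a ∨ p = b ∨ p = d) (ha : DominatesAllBut G a b d)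
    (hb : DominatesAllBut G b a d) (hd : DominatesAllBut G d a b) :
    Even (Finset.univ.filter fun v => v ∉ S ∧ ¬ G.Adj a v).card := by
  apply even_card_of_forall_exists_unique_nonadj G
  intro v hv
  simp only [Finset.mem_filter, Finset.mem_univ, true_and] at hv ⊢
  obtain ⟨hvS, hav⟩ := hv
  have hv' := hvS
  simp only [hS, not_or] at hv'
  have hbv : G.Adj b v := by have := hd.dom v hv'.2.2; tauto
  have hdv : G.Adj d v := by have := hb.dom v hv'.2.1; tauto
  obtain ⟨p, y, hp, hpS⟩ := hc.exists_dominatesAllBut_mem ht hD v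
  have hpa : p = a := by
    rcases (hS p).1 hpS with rfl | rfl | rfl
    · rfl
    · exact absurd hbv hp.not_adj_left
    · exact absurd hdv hp.not_adj_left
  subst hpa
  have hyS : y ∉ S := by
    rw [hS]
    rintro (rfl | rfl | rfl)
    · exact hp.ne rfl
    · exact hp.not_adj_right hbv
    · exact hp.not_adj_right hdv
  have hy' := hyS
  simp only [hS, not_or] at hy'
  have hyb : G.Adj y b := by
    rcases hp.dom b (Ne.symm hv'.2.1) with e | e | e | e
    · exact absurd e ha.ne_left
    · exact absurd e.symm hy'.2.1
    · exact absurd e.symm ha.not_adj_left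
    · exact e
  have hyd : G.Adj y d := by
    rcases hp.dom d (Ne.symm hv'.2.2) with e | e | e | e
    · exact absurd e ha.ne_right
    · exact absurd e.symm hy'.2.2
    · exact absurd e.symm ha.not_adj_right
    · exact e
  refine ⟨y, ⟨hyS, ?_⟩, hp.ne_right, hp.not_adj_right, ?_⟩
  · obtain ⟨q, hq, hqy⟩ := hc.exists_not_adj ht hD y
    rcases (hS q).1 hq with rfl | rfl | rfl
    · exact hqy
    · exact absurd hyb.symm hqy
    · exact absurd hyd.symm hqy
  · rintro w ⟨hwS, hw⟩ hwv
    rcases hp.dom w hwv with e | e | e | e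
    · exact absurd (e ▸ hpS) hwS
    · exact Or.inl e
    · exact absurd e hw
    · exact Or.inr e

theorem not_even_card_of_triple [Fintype V] (hc : IsSeparation G S c)
    (hD : ∀ v, ∃ x y, DominatesAllBut G v x y) (ht : 4 ≤ Fintype.card ι) {a b d : V}
    (hS : ∀ p, p ∈ S ↔ p = a ∨ p = b ∨ p = d) (hS3 : S.card = 3) (ha : DominatesAllBut G a b d)
    (hb : DominatesAllBut G b a d) (hd : DominatesAllBut G d a b) :
    ¬ Even (Fintype.card V) := by
  classical
  have hA := hc.even_card_not_adj hD ht hS ha hb hd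
  have hB := hc.even_card_not_adj hD ht (fun p => (hS p).trans (by tauto)) hb ha hd.symm
  have hC := hc.even_card_not_adj hD ht (a := d) (b := a) (d := b)
    (fun p => (hS p).trans (by tauto)) hd ha.symm hb.symm
  have hab : ∀ v ∉ S, G.Adj a v ∨ G.Adj b v := fun v hv => by
    simp only [hS, not_or] at hv
    have := hd.dom v hv.2.2
    tauto
  have had : ∀ v ∉ S, G.Adj a v ∨ G.Adj d v := fun v hv => by
    simp only [hS, not_or] at hv
    have := hb.dom v hv.2.1
    tauto
  have hbd : ∀ v ∉ S, G.Adj b v ∨ G.Adj d v := fun v hv => by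
    simp only [hS, not_or] at hv
    have := ha.dom v hv.1
    tauto
  have hunion : Sᶜ = (Finset.univ.filter fun v => v ∉ S ∧ ¬ G.Adj a v) ∪
      ((Finset.univ.filter fun v => v ∉ S ∧ ¬ G.Adj b v) ∪
        Finset.univ.filter fun v => v ∉ S ∧ ¬ G.Adj d v) := by
    ext v
    simp only [Finset.mem_compl, Finset.mem_union, Finset.mem_filter, Finset.mem_univ, true_and]
    constructor
    · intro hv
      obtain ⟨q, hq, hqv⟩ := hc.exists_not_adj ht hD v
      rcases (hS q).1 hq with rfl | rfl | rfl <;> tauto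
    · tauto
  have hcard := congrArg Finset.card hunion
  rw [Finset.card_union_of_disjoint, Finset.card_union_of_disjoint, Finset.card_compl, hS3] at hcard
  · have hle := Finset.card_le_univ S
    have heven := hA.add (hB.add hC)
    rw [← hcard] at heven
    intro hV
    rw [Nat.even_iff] at heven hV
    lia
  · rw [Finset.disjoint_left]
    intro v hv hv'
    simp only [Finset.mem_filter, Finset.mem_univ, true_and] at hv hv'
    have := hbd v hv.1
    tauto
  · rw [Finset.disjoint_left]
    intro v hv hv'
    simp only [Finset.mem_filter, Finset.mem_union, Finset.mem_univ, true_and] at hv hv'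
    have := hab v hv.1
    have := had v hv.1
    tauto

/-- A three-vertex set `S` with at least five labels is impossible if the pair dominating `G - a`,
for some `a ∈ S`, has a vertex outside `S`. -/
theorem false_of_exists_notMem (hc : IsSeparation G S c)
    (hD : ∀ v, ∃ x y, DominatesAllBut G v x y) (ht : 5 ≤ Fintype.card ι) {a b d : V}
    (hS : ∀ p, p ∈ S ↔ p = a ∨ p = b ∨ p = d) (ha : DominatesAllBut G a b x) (hx : x ∉ S) :
    False := by
  classical
  have ht4 : 4 ≤ Fintype.card ι := by lia
  have haS : a ∈ S := by simp [hS]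
  have hbS : b ∈ S := by simp [hS]
  have hdS : d ∈ S := by simp [hS]
  have hb : ∀ w ∉ S, c w ≠ c x → G.Adj b w := fun w hw hwx =>
    hc.adj_of_dominatesAllBut ha hbS hx hw (fun e => hw (e ▸ haS)) hwx
  have htype : ∀ v ∉ S, c v ≠ c x → DominatesAllBut G v a d ∨
      (∃ y ∉ S, DominatesAllBut G v a y) ∨ ∃ y ∉ S, DominatesAllBut G v d y := by
    intro v hv hvx
    obtain ⟨p, y, hp, hpS⟩ := hc.exists_dominatesAllBut_mem ht4 hD v
    have hpb : p ≠ b := by rintro rfl; exact hp.not_adj_left (hb v hv hvx)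
    have hyb : y ≠ b := by rintro rfl; exact hp.not_adj_right (hb v hv hvx)
    have hpy := hp.ne
    by_cases hy : y ∈ S
    · rw [hS] at hpS hy
      rcases hpS with rfl | rfl | rfl <;> rcases hy with rfl | rfl | rfl <;>
        first | contradiction | exact Or.inl hp | exact Or.inl hp.symm
    · rcases (hS p).1 hpS with rfl | rfl | rfl
      · exact Or.inr (Or.inl ⟨y, hy, hp⟩)
      · contradiction
      · exact Or.inr (Or.inr ⟨y, hy, hp⟩)
  have hnot : ∀ w ∉ S, c w ≠ c x → G.Adj a w → ¬ G.Adj d w := by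
    intro w hw hwx haw hdw
    obtain ⟨q, hq, hqw⟩ := hc.exists_not_adj ht4 hD w
    rcases (hS q).1 hq with rfl | rfl | rfl
    · exact hqw haw
    · exact hqw (hb w hw hwx)
    · exact hqw hdw
  have hA : ∀ v ∉ S, c v ≠ c x → (∃ y ∉ S, DominatesAllBut G v a y) →
      ∀ w ∉ S, c w ≠ c x → c w ≠ c v → G.Adj a w := by
    rintro v hv hvx ⟨y, hy, hd⟩ w hw hwx hwv
    have hyx : c x = c y := by
      by_contra hne
      exact ha.not_adj_right
        (hc.adj_of_dominatesAllBut hd haS hy hx (fun e => hvx (by rw [e])) hne).symm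
    exact hc.adj_of_dominatesAllBut hd haS hy hw (fun e => hwv (by rw [e])) (hyx ▸ hwx)
  have hC : ∀ v ∉ S, (∃ y ∉ S, DominatesAllBut G v d y) → ∀ w ∉ S, ∀ z ∉ S, c w ≠ c v →
      c z ≠ c v → c w ≠ c z → G.Adj d w ∨ G.Adj d z := by
    rintro v hv ⟨y, hy, hd⟩ w hw z hz hwv hzv hwz
    by_cases hwy : c w = c y
    · exact Or.inr (hc.adj_of_dominatesAllBut hd hdS hy hz (fun e => hzv (by rw [e]))
        (hwy ▸ hwz.symm))
    · exact Or.inl (hc.adj_of_dominatesAllBut hd hdS hy hw (fun e => hwv (by rw [e])) hwy)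
  obtain ⟨e⟩ : Nonempty (Fin 4 ↪ {i // i ≠ c x}) := by
    apply Function.Embedding.nonempty_of_card_le
    rw [Fintype.card_fin, Fintype.card_subtype_compl, Fintype.card_subtype_eq]
    lia
  choose r hrS hrc using fun k => hc.exists_label (e k).1
  have hrx : ∀ k, c (r k) ≠ c x := fun k => by rw [hrc]; exact (e k).2
  have hrinj : ∀ k l, k ≠ l → c (r k) ≠ c (r l) := fun k l hkl => by
    rw [hrc, hrc]
    exact fun h => hkl (e.injective (Subtype.ext h))
  have h3 : ∀ k l m, k ≠ l → k ≠ m → l ≠ m → (∃ y ∉ S, DominatesAllBut G (r k) d y) →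
      (∃ y ∉ S, DominatesAllBut G (r l) d y) → ¬ ∃ y ∉ S, DominatesAllBut G (r m) d y := by
    rintro k l m hkl hkm hlm hk ⟨y, -, hl⟩ ⟨z, -, hm⟩
    rcases hC _ (hrS k) hk _ (hrS l) _ (hrS m) (hrinj _ _ hkl.symm) (hrinj _ _ hkm.symm)
      (hrinj _ _ hlm) with h | h
    · exact hl.not_adj_left h
    · exact hm.not_adj_left h
  have h2 : ∀ k l, k ≠ l → (∃ y ∉ S, DominatesAllBut G (r k) a y) →
      ∃ y ∉ S, DominatesAllBut G (r l) d y := by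
    intro k l hkl hk
    have hal := hA _ (hrS k) (hrx k) hk _ (hrS l) (hrx l) (hrinj _ _ hkl.symm)
    rcases htype _ (hrS l) (hrx l) with h | ⟨y, -, h⟩ | h
    · exact absurd hal h.not_adj_left
    · exact absurd hal h.not_adj_left
    · exact h
  have h1 : ∀ k l, k ≠ l → DominatesAllBut G (r k) a d → ¬ DominatesAllBut G (r l) a d :=
    fun k l hkl hk hl => hrinj k l hkl (by rw [hk.unique hl])
  have h0 := fun k => htype _ (hrS k) (hrx k)
  by_cases hex : ∃ k, ∃ y ∉ S, DominatesAllBut G (r k) a y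
  · obtain ⟨k, hk⟩ := hex
    have hne : ∀ j : Fin 3, k ≠ k.succAbove j := fun j => (Fin.succAbove_ne k j).symm
    refine h3 (k.succAbove 0) (k.succAbove 1) (k.succAbove 2) ?_ ?_ ?_
      (h2 _ _ (hne 0) hk) (h2 _ _ (hne 1) hk) (h2 _ _ (hne 2) hk) <;> simp
  · have h0' : ∀ k, DominatesAllBut G (r k) a d ∨ ∃ y ∉ S, DominatesAllBut G (r k) d y :=
      fun k => (h0 k).imp_right fun h => h.resolve_left fun h => hex ⟨k, h⟩
    have hne : ∀ k, DominatesAllBut G (r k) a d → False := by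
      intro k hk
      have hne : ∀ j : Fin 3, k ≠ k.succAbove j := fun j => (Fin.succAbove_ne k j).symm
      have hj := fun j => (h0' (k.succAbove j)).resolve_left (h1 _ _ (hne j) hk)
      refine h3 (k.succAbove 0) (k.succAbove 1) (k.succAbove 2) ?_ ?_ ?_ (hj 0) (hj 1) (hj 2) <;>
        simp
    have hj := fun j => (h0' j).resolve_left (hne j)
    exact h3 0 1 2 (by decide) (by decide) (by decide) (hj 0) (hj 1) (hj 2)

theorem not_even_card_of_card_three [Fintype V] (hc : IsSeparation G S c)
    (hD : ∀ v, ∃ x y, DominatesAllBut G v x y) (ht : 5 ≤ Fintype.card ι) (hS : S.card = 3) :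
    ¬ Even (Fintype.card V) := by
  classical
  have ht4 : 4 ≤ Fintype.card ι := by lia
  have key : ∀ a b d, (∀ p, p ∈ S ↔ p = a ∨ p = b ∨ p = d) → DominatesAllBut G a b d := by
    intro a b d hS'
    obtain ⟨x, y, hd, hx⟩ := hc.exists_dominatesAllBut_mem ht4 hD a
    have hx' := ((hS' x).1 hx).resolve_left hd.ne_left
    by_cases hy : y ∈ S
    · have hy' := ((hS' y).1 hy).resolve_left hd.ne_right
      have hxy := hd.ne
      rcases hx' with rfl | rfl <;> rcases hy' with rfl | rfl
      · contradiction
      · exact hd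
      · exact hd.symm
      · contradiction
    · exfalso
      rcases hx' with rfl | rfl
      · exact hc.false_of_exists_notMem hD ht hS' hd hy
      · exact hc.false_of_exists_notMem hD ht (fun p => (hS' p).trans (by tauto)) hd hy
  obtain ⟨a, b, d, -, -, -, hSe⟩ := Finset.card_eq_three.1 hS
  have hS' : ∀ p, p ∈ S ↔ p = a ∨ p = b ∨ p = d := by simp [hSe]
  exact hc.not_even_card_of_triple hD ht4 hS' hS (key a b d hS')
    (key b a d fun p => (hS' p).trans (by tauto)) (key d a b fun p => (hS' p).trans (by tauto))

theorem false_of_card_four (hc : IsSeparation G S c) (hfree : StarFree G 5)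
    (hD : ∀ v, ∃ x y, DominatesAllBut G v x y) (ht : 6 ≤ Fintype.card ι) (hS : S.card = 4) :
    False := by
  classical
  have key : ∀ u x y d, u ∈ S → x ∈ S → y ∈ S → d ∈ S → d ≠ u → d ≠ x → d ≠ y →
      DominatesAllBut G u x y → ¬ G.Adj x d := by
    intro u x y d hu hx hy hdS hdu hdx hdy hd hadj
    have hS' : ∀ p ∈ S, p = u ∨ p = x ∨ p = y ∨ p = d := by
      have hsub : ({u, x, y, d} : Finset V) ⊆ S := by
        simp [Finset.insert_subset_iff, hu, hx, hy, hdS]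
      have h4 : ({u, x, y, d} : Finset V).card = 4 := by
        rw [Finset.card_insert_of_notMem (by simp [hd.ne_left.symm, hd.ne_right.symm, hdu.symm]),
          Finset.card_insert_of_notMem (by simp [hd.ne, hdx.symm]), Finset.card_pair hdy.symm]
      have := Finset.eq_of_subset_of_card_le hsub (by rw [hS, h4])
      intro p hp
      simpa [← this] using hp
    have huy : ∀ z, z = x ∨ z = d → DominatesAllBut G z u y := by
      intro z hz
      obtain ⟨p, q, hpq⟩ := hD z
      have hzS : z ∈ S := by rcases hz with rfl | rfl <;> assumption
      obtain ⟨hp, hq⟩ := hc.mem_and_mem_of_mem hfree ht hpq hzS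
      have hz' : ∀ p ∈ S, p ≠ z → ¬ G.Adj p z → p = u ∨ p = y := by
        intro p hp hpz hadj'
        rcases hS' p hp with e | rfl | e | rfl
        · exact Or.inl e
        · rcases hz with rfl | rfl
          · exact absurd rfl hpz
          · exact absurd hadj hadj'
        · exact Or.inr e
        · rcases hz with rfl | rfl
          · exact absurd hadj.symm hadj'
          · exact absurd rfl hpz
      have hne := hpq.ne
      rcases hz' p hp hpq.ne_left hpq.not_adj_left with rfl | rfl <;>
        rcases hz' q hq hpq.ne_right hpq.not_adj_right with rfl | rfl
      · contradiction
      · exact hpq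
      · exact hpq.symm
      · contradiction
    exact hdx ((huy d (Or.inr rfl)).unique (huy x (Or.inl rfl)))
  obtain ⟨u, hu⟩ := Finset.card_pos.1 (show 0 < S.card by lia)
  obtain ⟨x, y, hd⟩ := hD u
  obtain ⟨hx, hy⟩ := hc.mem_and_mem_of_mem hfree ht hd hu
  obtain ⟨d, hdS, hd'⟩ : ∃ d ∈ S, d ∉ ({u, x, y} : Finset V) := by
    apply Finset.exists_mem_notMem_of_card_lt_card
    exact Finset.card_le_three.trans_lt (by lia)
  simp only [Finset.mem_insert, Finset.mem_singleton, not_or] at hd'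
  rcases hd.dom d hd'.1 with e | e | e | e
  · exact hd'.2.1 e
  · exact hd'.2.2 e
  · exact key u x y d hu hx hy hdS hd'.1 hd'.2.1 hd'.2.2 hd e
  · exact key u y x d hu hy hx hdS hd'.1 hd'.2.2 hd'.2.1 hd.symm e

theorem false_of_five_le_card [Fintype V] (hc : IsSeparation G S c) (hfree : StarFree G 5)
    (hD : ∀ v, ∃ x y, DominatesAllBut G v x y) (ht : S.card + 2 ≤ Fintype.card ι)
    (hS : 5 ≤ S.card) : False := by
  classical
  choose x y hd using hD
  have hmem := fun v => hc.mem_and_mem hfree (by lia) (hd v)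
  have hn := hc.two_mul_card_add_two_le ht
  obtain ⟨u, hu⟩ := Finset.card_pos.1 (show 0 < S.card by lia)
  set N := dominatedLabels G S c with hN
  have hN4 : ∀ p, (N p).card ≤ 4 := hc.card_dominatedLabels_le_four hfree
  have hNu := hc.card_le_add_of_mem (hd u) hu
  have hinj : Function.Injective fun v => ({x v, y v} : Finset V) := by
    intro v w hvw
    have hsub : ({x v, y v} : Finset V) = {x w, y w} := hvw
    have h1 : x v = x w ∨ x v = y w := by
      have : x v ∈ ({x w, y w} : Finset V) := hsub ▸ by simp
      simpa using this
    have h2 : y v = x w ∨ y v = y w := by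
      have : y v ∈ ({x w, y w} : Finset V) := hsub ▸ by simp
      simpa using this
    have hne := (hd v).ne
    rcases h1 with h1 | h1 <;> rcases h2 with h2 | h2
    · exact absurd (h1.trans h2.symm) hne
    · exact (hd v).unique (h1 ▸ h2 ▸ hd w)
    · exact (hd v).unique (h1 ▸ h2 ▸ (hd w).symm)
    · exact absurd (h1.trans h2.symm) hne
  set I : Finset (Finset V) := Finset.univ.image fun v => ({x v, y v} : Finset V) with hI
  have hIcard : I.card = Fintype.card V := by
    rw [hI, Finset.card_image_of_injective _ hinj, Finset.card_univ]
  have hIsub : I ⊆ S.powersetCard 2 := by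
    intro s hs
    obtain ⟨v, -, rfl⟩ := Finset.mem_image.1 hs
    rw [Finset.mem_powersetCard]
    exact ⟨by simp [Finset.insert_subset_iff, hmem v], Finset.card_pair (hd v).ne⟩
  obtain h5 | h6 : S.card = 5 ∨ S.card = 6 := by
    have := hN4 (x u)
    have := hN4 (y u)
    lia
  · have := Finset.card_le_card hIsub
    rw [Finset.card_powersetCard, h5, hIcard, show Nat.choose 5 2 = 10 from rfl] at this
    lia
  have hunion : ∀ p q, {p, q} ∈ I → 7 ≤ (N p ∪ N q).card := by
    intro p q hpq
    obtain ⟨v, -, hv⟩ := Finset.mem_image.1 hpq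
    have h := hc.card_union (hd v)
    have e : N (x v) ∪ N (y v) = N p ∪ N q := by
      have := congrArg (fun s => s.biUnion N) hv
      simpa [Finset.biUnion_insert] using this
    rw [← hN, e] at h
    lia
  have hbad : ∀ z ∈ S, z ≠ x u → z ≠ y u →
      ∃ p, (p = x u ∨ p = y u) ∧ {p, z} ∉ I := by
    intro z hz hzx hzy
    by_contra! h
    have h1 := hunion _ _ (h _ (Or.inl rfl))
    have h2 := hunion _ _ (h _ (Or.inr rfl))
    have h3 := hc.card_union_of_mem (hd u) hu
    rw [← hN] at h3
    have hsub : N z ⊆ (N (x u) ∩ N z) ∪ (N (y u) ∩ N z) := by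
      have huniv := Finset.eq_univ_of_card _ (le_antisymm (Finset.card_le_univ _) h3)
      rw [← Finset.union_inter_distrib_right, huniv, Finset.univ_inter]
    have h4 := (Finset.card_le_card hsub).trans (Finset.card_union_le _ _)
    have h5 := Finset.card_union_add_card_inter (N (x u)) (N z)
    have h6 := Finset.card_union_add_card_inter (N (y u)) (N z)
    have h7 := hN4 (x u)
    have h8 := hN4 (y u)
    have h9 := hN4 z
    lia
  obtain ⟨z, hz, hz'⟩ : ∃ d ∈ S, d ∉ ({x u, y u} : Finset V) := by
    apply Finset.exists_mem_notMem_of_card_lt_card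
    exact Finset.card_le_two.trans_lt (by lia)
  obtain ⟨z', hzz, hzz'⟩ : ∃ d ∈ S, d ∉ ({x u, y u, z} : Finset V) := by
    apply Finset.exists_mem_notMem_of_card_lt_card
    exact Finset.card_le_three.trans_lt (by lia)
  simp only [Finset.mem_insert, Finset.mem_singleton, not_or] at hz' hzz'
  obtain ⟨p, hp, hpI⟩ := hbad z hz hz'.1 hz'.2
  obtain ⟨q, hq, hqI⟩ := hbad z' hzz hzz'.1 hzz'.2.1
  have hpS : p ∈ S := by rcases hp with rfl | rfl <;> simp [hmem u]
  have hqS : q ∈ S := by rcases hq with rfl | rfl <;> simp [hmem u]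
  have hpz : p ≠ z := by rcases hp with rfl | rfl <;> tauto
  have hqz : q ≠ z' := by rcases hq with rfl | rfl <;> tauto
  have hpz' : z' ≠ p := by rcases hp with rfl | rfl <;> tauto
  have hne : ({p, z} : Finset V) ≠ {q, z'} := by
    intro e
    have : z' ∈ ({p, z} : Finset V) := e ▸ by simp
    simp only [Finset.mem_insert, Finset.mem_singleton] at this
    exact this.elim hpz' hzz'.2.2
  have hsub : insert {p, z} (insert {q, z'} I) ⊆ S.powersetCard 2 := by
    rw [Finset.insert_subset_iff, Finset.insert_subset_iff]
    refine ⟨?_, ?_, hIsub⟩ <;> rw [Finset.mem_powersetCard]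
    · exact ⟨by simp [Finset.insert_subset_iff, hpS, hz], Finset.card_pair hpz⟩
    · exact ⟨by simp [Finset.insert_subset_iff, hqS, hzz], Finset.card_pair hqz⟩
  have hle := Finset.card_le_card hsub
  rw [Finset.card_insert_of_notMem (by simp [hne, hpI]), Finset.card_insert_of_notMem hqI, hIcard,
    Finset.card_powersetCard, h6, show Nat.choose 6 2 = 15 from rfl] at hle
  lia

end IsSeparation

end Labels

section Closed

variable {V : Type*} [Fintype V] {G : SimpleGraph V}

/-- If the vertices outside a nonempty set `P` closed under adjacency cannot be dominated by a
single one of them, then `P` is a singleton and `G` has odd order. -/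
theorem not_even_card_of_closed (hD : ∀ v, ∃ x y, DominatesAllBut G v x y) {P : V → Prop}
    (hP : ∀ v w, G.Adj v w → (P v ↔ P w)) {a b : V} (ha : P a) (hb : ¬ P b)
    (hdom : ¬ ∃ x, ¬ P x ∧ ∀ w, ¬ P w → w = x ∨ G.Adj x w) : ¬ Even (Fintype.card V) := by
  classical
  have hside : ∀ v w, w ≠ v → ∃ x y, DominatesAllBut G v x y ∧ (P w ↔ P x) := by
    intro v w hw
    obtain ⟨x, y, h⟩ := hD v
    rcases h.dom w hw with e | e | e | e
    · exact ⟨x, y, h, by rw [e]⟩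
    · exact ⟨y, x, h.symm, by rw [e]⟩
    · exact ⟨x, y, h, (hP _ _ e).symm⟩
    · exact ⟨y, x, h.symm, (hP _ _ e).symm⟩
  have hsingle : ∀ w, P w → w = a := by
    intro w hw
    by_contra hwa
    obtain ⟨x, y, h, hx⟩ := hside a b (by rintro rfl; exact hb ha)
    have hx : ¬ P x := fun h' => hb (hx.2 h')
    by_cases hy : P y
    · refine hdom ⟨x, hx, fun z hz => ?_⟩
      rcases h.dom z (by rintro rfl; exact hz ha) with e | e | e | e
      · exact Or.inl e
      · exact absurd (e ▸ hy) hz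
      · exact Or.inr e
      · exact absurd ((hP _ _ e).1 hy) hz
    · rcases h.dom w hwa with e | e | e | e
      · exact hx (e ▸ hw)
      · exact hy (e ▸ hw)
      · exact hx ((hP _ _ e).2 hw)
      · exact hy ((hP _ _ e).2 hw)
  have heven : Even (Finset.univ.erase a).card := by
    apply even_card_of_forall_exists_unique_nonadj G
    intro v hv
    obtain ⟨x, y, h, hx⟩ := hside v a (Finset.ne_of_mem_erase hv).symm
    have hxa := hsingle x (hx.1 ha)
    subst hxa
    refine ⟨y, by simp [h.ne.symm], h.ne_right, h.not_adj_right, fun w hw hwv => ?_⟩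
    have hwx := Finset.ne_of_mem_erase hw
    rcases h.dom w hwv with e | e | e | e
    · exact absurd e hwx
    · exact Or.inl e
    · exact absurd (hsingle w ((hP _ _ e).1 ha)) hwx
    · exact Or.inr e
  rw [Finset.card_erase_of_mem (Finset.mem_univ a), Finset.card_univ] at heven
  have : 0 < Fintype.card V := Fintype.card_pos_iff.2 ⟨a⟩
  intro hV
  rw [Nat.even_iff] at heven hV
  lia

theorem IsSeparation.not_even_card_of_empty {ι : Type*} [Fintype ι] {c : V → ι}
    (hc : IsSeparation G ∅ c) (hcrit : GammaCritical G 3) (ht : 2 ≤ Fintype.card ι) :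
    ¬ Even (Fintype.card V) := by
  obtain ⟨i, j, hij⟩ := Fintype.one_lt_card_iff.1 (show 1 < Fintype.card ι by lia)
  obtain ⟨a, -, ha⟩ := hc.exists_label i
  obtain ⟨b, -, hb⟩ := hc.exists_label j
  have hb' : c b ≠ i := by rw [hb]; exact hij.symm
  have hP : ∀ v w, G.Adj v w → (c v = i ↔ c w = i) := fun v w h => by
    rw [hc.label_eq (by simp) (by simp) h]
  have hD := hcrit.exists_dominatesAllBut
  by_cases h1 : ∃ x, ¬ c x = i ∧ ∀ w, ¬ c w = i → w = x ∨ G.Adj x w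
  swap
  · exact not_even_card_of_closed hD hP ha hb' h1
  by_cases h2 : ∃ x, ¬ ¬ c x = i ∧ ∀ w, ¬ ¬ c w = i → w = x ∨ G.Adj x w
  swap
  · exact not_even_card_of_closed hD (fun v w h => not_congr (hP v w h)) hb' (not_not.2 ha) h2
  obtain ⟨x, -, hx⟩ := h1
  obtain ⟨y, -, hy⟩ := h2
  obtain ⟨v, n1, n2, n3, n4⟩ := hcrit.exists_not_dominated x y
  by_cases hv : c v = i
  · exact ((hy v (not_not.2 hv)).elim n2 n4).elim
  · exact ((hx v hv).elim n1 n3).elim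

end Closed

/-- In a graph of even order without a perfect matching, some set `S` separates the rest of the
graph into at least `|S| + 2` parts. -/
theorem exists_isSeparation {V : Type*} [Fintype V] (G : SimpleGraph V)
    (heven : Even (Fintype.card V)) (hpm : ¬ HasPerfectMatching G) :
    ∃ (S : Finset V) (n : ℕ) (c : V → Fin n), IsSeparation G S c ∧ S.card + 2 ≤ n := by
  classical
  rw [HasPerfectMatching, SimpleGraph.tutte] at hpm
  push Not at hpm
  obtain ⟨u, hu⟩ := hpm
  rw [IsTutteViolator] at hu
  set H := ((⊤ : G.Subgraph).deleteVerts u) with hH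
  have hverts : ∀ v, v ∈ H.verts ↔ v ∉ u := by simp [hH]
  have hodd := H.coe.odd_ncard_oddComponents
  have hcard : Nat.card H.verts + u.ncard = Fintype.card V := by
    have : H.verts = uᶜ := by ext v; simp [hverts]
    rw [this, Nat.card_coe_set_eq, ← Nat.card_eq_fintype_card, add_comm,
      Set.ncard_add_ncard_compl]
  have hle : H.coe.oddComponents.ncard ≤ Nat.card H.coe.ConnectedComponent := by
    rw [← Set.ncard_univ]
    exact Set.ncard_le_ncard (Set.subset_univ _)
  have hge : u.ncard + 2 ≤ H.coe.oddComponents.ncard := by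
    rw [Nat.odd_iff, Nat.odd_iff] at hodd
    rw [Nat.even_iff] at heven
    lia
  let e := Finite.equivFin H.coe.ConnectedComponent
  have : NeZero (Nat.card H.coe.ConnectedComponent) := ⟨by lia⟩
  refine ⟨u.toFinset, _, fun v => if h : v ∈ H.verts then e (H.coe.connectedComponentMk ⟨v, h⟩)
    else 0, ⟨?_, ?_⟩, ?_⟩
  · intro v w hv hw hadj
    rw [Set.mem_toFinset, ← hverts] at hv hw
    simp only [hv, hw, dif_pos]
    congr 1
    rw [ConnectedComponent.eq]
    apply Adj.reachable
    rw [hverts] at hv hw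
    simp [hH, hv, hw, hadj]
  · intro i
    obtain ⟨⟨v, hv⟩, hvi⟩ := (e.symm i).exists_rep
    refine ⟨v, by rwa [Set.mem_toFinset, ← hverts], ?_⟩
    simp only [hv, dif_pos]
    rw [← Equiv.eq_symm_apply]
    exact hvi
  · rw [← Set.ncard_eq_toFinset_card']
    lia

/-- Ananchuen–Plummer: a `3`-`γ`-vertex-critical `K_{1,5}`-free graph of
even order has a perfect matching. -/
theorem three_gamma_critical_K15_free_even_perfectMatching
    {V : Type*} [Fintype V] (G : SimpleGraph V)
    (hcrit : GammaCritical G 3) (heven : Even (Fintype.card V))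
    (hfree : StarFree G 5) :
    HasPerfectMatching G := by
  by_contra hpm
  obtain ⟨S, n, c, hc, hn⟩ := exists_isSeparation G heven hpm
  have hD := hcrit.exists_dominatesAllBut
  have ht : S.card + 2 ≤ Fintype.card (Fin n) := by rwa [Fintype.card_fin]
  by_cases h5 : 5 ≤ S.card
  · exact hc.false_of_five_le_card hfree hD ht h5
  have h4 : S.card < 5 := by lia
  interval_cases h : S.card
  · rw [Finset.card_eq_zero] at h
    subst h
    exact hc.not_even_card_of_empty hcrit ht heven
  · exact hc.false_of_card_one hD ht h
  · exact hc.false_of_card_two hD ht h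
  · exact hc.not_even_card_of_card_three hD ht h heven
  · exact hc.false_of_card_four hfree hD ht h
end

section
/- Let G be a 3-γ-vertex-critical graph of odd order at least 11. If G is K_{1,5}-free, then G contains a near perfect matching. -/
open SimpleGraph

/-- The cone over `G`: a new vertex `none` joined to every vertex of `G`. -/
def coneGraph {V : Type*} (G : SimpleGraph V) : SimpleGraph (Option V) where
  Adj x y := x ≠ y ∧ ∀ u ∈ x, ∀ v ∈ y, G.Adj u v
  symm := ⟨fun _ _ h => ⟨h.1.symm, fun u hu v hv => (h.2 v hv u hu).symm⟩⟩
  loopless := ⟨fun _ h => h.1 rfl⟩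

theorem coneGraph_adj_some {V : Type*} {G : SimpleGraph V} {u v : V} :
    (coneGraph G).Adj (some u) (some v) ↔ G.Adj u v := by
  constructor
  · intro h
    exact h.2 u rfl v rfl
  · intro h
    refine ⟨by simpa using h.ne, ?_⟩
    rintro _ ⟨⟩ _ ⟨⟩
    exact h

theorem coneGraph_adj_none {V : Type*} (G : SimpleGraph V) {x : Option V} (hx : x ≠ none) :
    (coneGraph G).Adj none x :=
  ⟨hx.symm, by simp⟩

/-- A perfect matching of the cone restricts to a near perfect matching. -/
theorem hasNearPerfectMatching_of_coneGraph {V : Type*} {G : SimpleGraph V}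
    {M : (coneGraph G).Subgraph} (hM : M.IsPerfectMatching) : HasNearPerfectMatching G := by
  rw [Subgraph.isPerfectMatching_iff] at hM
  obtain ⟨w, hw, -⟩ := hM none
  obtain _ | v := w
  · exact absurd rfl hw.ne
  refine ⟨{ verts := {v}ᶜ
            Adj := fun a b => M.Adj (some a) (some b)
            adj_sub := fun h => coneGraph_adj_some.1 h.adj_sub
            edge_vert := ?_
            symm := ⟨fun _ _ h => h.symm⟩ }, v, ?_, rfl⟩
  · rintro a b h rfl
    cases (hM (some a)).unique h hw.symm
  · intro a ha
    obtain ⟨b, hb, huniq⟩ := hM (some a)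
    obtain _ | b := b
    · cases (hM none).unique hw hb.symm
      exact absurd rfl ha
    · exact ⟨b, hb, fun c hc => Option.some_injective _ (huniq _ hc)⟩

/-- In a graph of odd order without near perfect matching, some vertex set `S` leaves at least
`|S| + 3` components; these are recorded by a labelling `p`. -/
theorem exists_labelling_of_not_hasNearPerfectMatching {V : Type*} [Fintype V]
    {G : SimpleGraph V} (hodd : Odd (Fintype.card V)) (h : ¬ HasNearPerfectMatching G) :
    ∃ (S : Finset V) (n : ℕ) (p : V → Fin n),
      (∀ u v, u ∉ S → v ∉ S → G.Adj u v → p u = p v) ∧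
      (∀ k, ∃ v, v ∉ S ∧ p v = k) ∧ S.card + 3 ≤ n := by
  classical
  have hcard : Nat.card (Option V) = Fintype.card V + 1 := by simp
  have hev : Even (Nat.card (Option V)) := by
    rw [hcard]
    exact hodd.add_one
  obtain ⟨T, hT⟩ := exists_isTutteViolator
    (fun M hM => h (hasNearPerfectMatching_of_coneGraph (G := G) hM)) hev
  unfold IsTutteViolator at hT
  set H := ((⊤ : (coneGraph G).Subgraph).deleteVerts T).coe with hH
  have hpar := odd_ncard_oddComponents H
  have hverts : Nat.card ((⊤ : (coneGraph G).Subgraph).deleteVerts T).verts + T.ncard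
      = Nat.card (Option V) := by
    have : ((⊤ : (coneGraph G).Subgraph).deleteVerts T).verts = Tᶜ := by
      ext; simp
    rw [this, Nat.card_coe_set_eq, add_comm, Set.ncard_add_ncard_compl]
  have hT2 : T.ncard + 2 ≤ H.oddComponents.ncard := by
    by_contra hlt
    have heq : H.oddComponents.ncard = T.ncard + 1 := by omega
    rw [heq] at hpar
    rw [← hverts] at hev
    grind
  have hle : H.oddComponents.ncard ≤ Nat.card H.ConnectedComponent := Set.ncard_le_card _
  have hadj : ∀ a b : ((⊤ : (coneGraph G).Subgraph).deleteVerts T).verts,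
      (coneGraph G).Adj a b → H.Adj a b := by
    intro a b hab
    have ha := a.2
    have hb := b.2
    simp only [Subgraph.deleteVerts_verts, Subgraph.verts_top, Set.mem_sdiff] at ha hb
    simp [hH, hab, ha.2, hb.2]
  have hnone : none ∈ T := by
    by_contra hn
    let z : ((⊤ : (coneGraph G).Subgraph).deleteVerts T).verts := ⟨none, by simp [hn]⟩
    have hsub : Subsingleton H.ConnectedComponent := by
      have hz : ∀ a, H.connectedComponentMk z = H.connectedComponentMk a := by
        intro a
        rw [ConnectedComponent.eq]
        by_cases haz : a = z
        · rw [haz]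
        · refine (hadj z a (coneGraph_adj_none G fun hh => haz (Subtype.ext hh))).reachable
      refine ⟨fun c d => ?_⟩
      induction c using ConnectedComponent.ind with | _ a
      induction d using ConnectedComponent.ind with | _ b
      rw [← hz a, ← hz b]
    have := Finite.card_le_one_iff_subsingleton.2 hsub
    omega
  let S : Finset V := Finset.univ.filter fun v => some v ∈ T
  have hS : S.card + 1 ≤ T.ncard := by
    have hins : T.toFinset = insert none (S.map Function.Embedding.some) := by
      ext x
      cases x <;> simp [S, hnone]
    rw [Set.ncard_eq_toFinset_card', hins, Finset.card_insert_of_notMem (by simp),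
      Finset.card_map]
  have hpos : 0 < Nat.card H.ConnectedComponent := by omega
  let e := Finite.equivFin H.ConnectedComponent
  refine ⟨S, Nat.card H.ConnectedComponent, fun v =>
    if hv : some v ∈ T then ⟨0, hpos⟩ else e (H.connectedComponentMk ⟨some v, by simp [hv]⟩),
    ?_, ?_, by omega⟩
  · intro u v hu hv huv
    simp only [S, Finset.mem_filter, Finset.mem_univ, true_and] at hu hv
    simp only [hu, hv, dite_false, EmbeddingLike.apply_eq_iff_eq]
    rw [ConnectedComponent.eq]
    exact (hadj _ _ (coneGraph_adj_some.2 huv)).reachable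
  · intro k
    obtain ⟨c, rfl⟩ := e.surjective k
    induction c using ConnectedComponent.ind with | _ a
    obtain ⟨a, ha⟩ := a
    have haT : a ∉ T := by simpa using ha
    obtain _ | v := a
    · exact absurd hnone haT
    · exact ⟨v, by simpa [S] using haT, by simp [haT]⟩

/-- The closed neighbourhoods of `x` and `y` together contain `u`. -/
def DominatedByPair {V : Type*} (G : SimpleGraph V) (x y u : V) : Prop :=
  (u = x ∨ G.Adj x u) ∨ (u = y ∨ G.Adj y u)

/-- In a `3`-`γ`-vertex-critical graph, for every vertex `v` some pair dominates exactly
the vertices other than `v`. -/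
theorem GammaCritical.exists_pair {V : Type*} [Fintype V] {G : SimpleGraph V}
    (hcrit : GammaCritical G 3) (hV : 2 ≤ Fintype.card V) (v : V) :
    ∃ x y, (∀ u, u ≠ v → DominatedByPair G x y u) ∧ ¬ DominatedByPair G x y v := by
  classical
  obtain ⟨h3, hdel⟩ := hcrit
  have hne : {n | ∃ D : Set V, IsDomSetAvoiding G v D ∧ D.ncard = n}.Nonempty :=
    ⟨_, {v}ᶜ, ⟨by simp, fun u hu => Or.inl hu⟩, rfl⟩
  obtain ⟨D, ⟨-, hD⟩, hDc⟩ := Nat.sInf_mem hne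
  have hlt : D.ncard < 3 := hDc ▸ hdel v
  obtain ⟨x, y, hxy⟩ : ∃ x y, D = {x, y} := by
    have hcases : D.ncard = 0 ∨ D.ncard = 1 ∨ D.ncard = 2 := by omega
    rcases hcases with h | h | h
    · exfalso
      rw [Set.ncard_eq_zero] at h
      subst h
      have : Nontrivial V := Fintype.one_lt_card_iff_nontrivial.1 hV
      obtain ⟨w, hw⟩ := exists_ne v
      simpa using hD w hw
    · obtain ⟨x, rfl⟩ := Set.ncard_eq_one.1 h
      exact ⟨x, x, by simp⟩
    · obtain ⟨x, y, -, rfl⟩ := Set.ncard_eq_two.1 h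
      exact ⟨x, y, rfl⟩
  subst hxy
  have hdom : ∀ u, u ≠ v → DominatedByPair G x y u := by
    intro u hu
    have := hD u hu
    simp only [Set.mem_insert_iff, Set.mem_singleton_iff, exists_eq_or_imp,
      exists_eq_left] at this
    unfold DominatedByPair
    tauto
  refine ⟨x, y, hdom, fun hv => ?_⟩
  have hle : domNum G ≤ ({x, y} : Set V).ncard := by
    refine Nat.sInf_le ⟨_, fun u => ?_, rfl⟩
    have hu : DominatedByPair G x y u := by
      by_cases huv : u = v
      · exact huv ▸ hv
      · exact hdom u huv
    simp only [Set.mem_insert_iff, Set.mem_singleton_iff, exists_eq_or_imp, exists_eq_left]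
    unfold DominatedByPair at hu
    tauto
  omega

section Labelling

variable {V : Type*} {G : SimpleGraph V} {S : Finset V} {n : ℕ} {p : V → Fin n}

open Classical in
/-- The labels of the vertices outside `S` in the closed neighbourhood of `x`. -/
noncomputable def labelNeighbors (G : SimpleGraph V) (S : Finset V) (p : V → Fin n) (x : V) :
    Finset (Fin n) :=
  Finset.univ.filter fun k => ∃ u, u ∉ S ∧ p u = k ∧ (u = x ∨ G.Adj x u)

theorem mem_labelNeighbors {x : V} {k : Fin n} :
    k ∈ labelNeighbors G S p x ↔ ∃ u, u ∉ S ∧ p u = k ∧ (u = x ∨ G.Adj x u) := by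
  simp [labelNeighbors]

theorem card_labelNeighbors_le_one (hp : ∀ u v, u ∉ S → v ∉ S → G.Adj u v → p u = p v)
    {x : V} (hx : x ∉ S) : (labelNeighbors G S p x).card ≤ 1 := by
  rw [← Finset.card_singleton (p x)]
  refine Finset.card_le_card fun k hk => ?_
  obtain ⟨u, hu, rfl, rfl | hxu⟩ := mem_labelNeighbors.1 hk
  · simp
  · simp [hp x u hx hu hxu]

theorem card_labelNeighbors_lt (hp : ∀ u v, u ∉ S → v ∉ S → G.Adj u v → p u = p v)
    {m : ℕ} (hfree : StarFree G m) {x : V} (hx : x ∈ S) :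
    (labelNeighbors G S p x).card < m := by
  classical
  by_contra! hm
  obtain ⟨K, hK, hKm⟩ := Finset.exists_subset_card_eq hm
  have hrep : ∀ k : Fin n, ∃ u, k ∈ K → u ∉ S ∧ p u = k ∧ G.Adj x u := by
    intro k
    by_cases hk : k ∈ K
    · obtain ⟨u, hu, hpu, rfl | hxu⟩ := mem_labelNeighbors.1 (hK hk)
      · exact absurd hx hu
      · exact ⟨u, fun _ => ⟨hu, hpu, hxu⟩⟩
    · exact ⟨x, fun h => absurd h hk⟩
  choose f hf using hrep
  have hfS := fun k hk => (hf k hk).1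
  have hfp := fun k hk => (hf k hk).2.1
  have hfx := fun k hk => (hf k hk).2.2
  refine hfree ⟨x, K.image f, ?_, ?_, ?_⟩
  · rw [Finset.card_image_of_injOn, hKm]
    intro a ha b hb hab
    rw [← hfp a ha, ← hfp b hb, hab]
  · simpa using hfx
  · simp only [Finset.mem_image]
    rintro _ ⟨a, ha, rfl⟩ _ ⟨b, hb, rfl⟩ hne hadj
    have := hp _ _ (hfS a ha) (hfS b hb) hadj
    rw [hfp a ha, hfp b hb] at this
    exact hne (congrArg f this)

/-- If a pair dominates all vertices but `v`, then it reaches every label carried by a vertex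
outside `S` other than `v`. -/
theorem le_card_labelNeighbors_add {x y v : V} (hsurj : ∀ k, ∃ u, u ∉ S ∧ u ≠ v ∧ p u = k)
    (hdom : ∀ u, u ≠ v → DominatedByPair G x y u) :
    n ≤ (labelNeighbors G S p x).card + (labelNeighbors G S p y).card := by
  classical
  have : (Finset.univ : Finset (Fin n)) ⊆ labelNeighbors G S p x ∪ labelNeighbors G S p y := by
    intro k _
    obtain ⟨u, hu, huv, hpu⟩ := hsurj k
    rw [Finset.mem_union, mem_labelNeighbors, mem_labelNeighbors]
    exact (hdom u huv).imp (fun h => ⟨u, hu, hpu, h⟩) (fun h => ⟨u, hu, hpu, h⟩)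
  simpa using (Finset.card_le_card this).trans (Finset.card_union_le _ _)

theorem le_card_labelNeighbors_add_one {x y v : V} (hsurj : ∀ k, ∃ u, u ∉ S ∧ p u = k)
    (hdom : ∀ u, u ≠ v → DominatedByPair G x y u) :
    n ≤ (labelNeighbors G S p x).card + (labelNeighbors G S p y).card + 1 := by
  classical
  have : (Finset.univ : Finset (Fin n)) ⊆
      insert (p v) (labelNeighbors G S p x ∪ labelNeighbors G S p y) := by
    intro k _
    obtain ⟨u, hu, hpu⟩ := hsurj k
    rw [Finset.mem_insert, Finset.mem_union, mem_labelNeighbors, mem_labelNeighbors]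
    by_cases huv : u = v
    · exact Or.inl (huv ▸ hpu.symm)
    · exact Or.inr ((hdom u huv).imp (fun h => ⟨u, hu, hpu, h⟩) (fun h => ⟨u, hu, hpu, h⟩))
  have h1 := (Finset.card_le_card this).trans (Finset.card_insert_le _ _)
  have h2 := Finset.card_union_le (labelNeighbors G S p x) (labelNeighbors G S p y)
  simp only [Finset.card_univ, Fintype.card_fin] at h1
  omega

theorem card_le_card_add_of_label_injOn [Fintype V]
    (hinj : ∀ u v, u ∉ S → v ∉ S → p u = p v → u = v) : Fintype.card V ≤ S.card + n := by
  classical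
  have h1 : Sᶜ.card ≤ (Finset.univ : Finset (Fin n)).card :=
    Finset.card_le_card_of_injOn p (by simp) fun u hu v hv huv =>
      hinj u v (by simpa using hu) (by simpa using hv) huv
  have h2 := Finset.card_add_card_compl S
  simp only [Finset.card_univ, Fintype.card_fin] at h1
  omega

/-- A `3`-`γ`-vertex-critical `K_{1,5}`-free graph on at least `11` vertices has no vertex set `S`
whose removal leaves at least `|S| + 3` components. -/
theorem GammaCritical.labelling_false [Fintype V] (hcrit : GammaCritical G 3)
    (h11 : 11 ≤ Fintype.card V) (hfree : StarFree G 5)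
    (hp : ∀ u v, u ∉ S → v ∉ S → G.Adj u v → p u = p v)
    (hsurj : ∀ k, ∃ v, v ∉ S ∧ p v = k) (hn : S.card + 3 ≤ n) : False := by
  classical
  choose x y hdom hnot using hcrit.exists_pair (by omega)
  have hxS : ∀ {a}, a ∈ S → (labelNeighbors G S p a).card ≤ 4 := fun ha =>
    Nat.le_of_lt_succ (card_labelNeighbors_lt hp hfree ha)
  have hxN : ∀ {a}, a ∉ S → (labelNeighbors G S p a).card ≤ 1 := fun ha =>
    card_labelNeighbors_le_one hp ha
  have hx4 : ∀ a, (labelNeighbors G S p a).card ≤ 4 := fun a => by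
    by_cases ha : a ∈ S
    · exact hxS ha
    · exact (hxN ha).trans (by norm_num)
  have hany : ∀ v, n ≤ (labelNeighbors G S p (x v)).card + (labelNeighbors G S p (y v)).card + 1 :=
    fun v => le_card_labelNeighbors_add_one hsurj (hdom v)
  have hmem : ∀ v ∈ S,
      n ≤ (labelNeighbors G S p (x v)).card + (labelNeighbors G S p (y v)).card := by
    refine fun v hv => le_card_labelNeighbors_add (fun k => ?_) (hdom v)
    obtain ⟨u, hu, hk⟩ := hsurj k
    exact ⟨u, hu, fun h => hu (h ▸ hv), hk⟩
  have htwin : ∀ v w, v ∉ S → w ∉ S → p v = p w → v ≠ w →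
      n ≤ (labelNeighbors G S p (x v)).card + (labelNeighbors G S p (y v)).card := by
    refine fun v w hv hw hvw hne => le_card_labelNeighbors_add (fun k => ?_) (hdom v)
    obtain ⟨u, hu, hk⟩ := hsurj k
    by_cases huv : u = v
    · exact ⟨w, hw, hne.symm, by rw [← hvw, ← huv, hk]⟩
    · exact ⟨u, hu, huv, hk⟩
  have hne_x : ∀ v, x v ≠ v := fun v h => hnot v (Or.inl (Or.inl h.symm))
  have hne_y : ∀ v, y v ≠ v := fun v h => hnot v (Or.inr (Or.inl h.symm))
  have hpair : ∀ v w, ({x v, y v} : Finset V) = {x w, y w} → v = w := by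
    intro v w h
    have hiff : ∀ z u, DominatedByPair G (x z) (y z) u ↔
        ∃ a ∈ ({x z, y z} : Finset V), u = a ∨ G.Adj a u := by
      intro z u
      simp [DominatedByPair]
    by_contra hvw
    exact hnot v ((hiff v v).2 (h ▸ (hiff w v).1 (hdom w v hvw)))
  have hx_eq : ∀ v, x v = y v → n ≤ 5 := by
    intro v hv
    have hsub : (Finset.univ : Finset (Fin n)) ⊆ insert (p v) (labelNeighbors G S p (x v)) := by
      intro k _
      obtain ⟨u, hu, hk⟩ := hsurj k
      rw [Finset.mem_insert, mem_labelNeighbors]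
      by_cases huv : u = v
      · exact Or.inl (huv ▸ hk.symm)
      · have := hdom v u huv
        rw [← hv] at this
        exact Or.inr ⟨u, hu, hk, this.elim id id⟩
    have h1 := (Finset.card_le_card hsub).trans (Finset.card_insert_le _ _)
    simp only [Finset.card_univ, Fintype.card_fin] at h1
    have := hx4 (x v)
    omega
  have hcard_pair : 6 ≤ n → ∀ v, ({x v, y v} : Finset V).card = 2 := by
    intro h6 v
    refine Finset.card_pair fun h => ?_
    have := hx_eq v h
    omega
  have hpair_subset : ∀ v, 4 + 1 < (labelNeighbors G S p (x v)).card +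
      (labelNeighbors G S p (y v)).card → ({x v, y v} : Finset V) ⊆ S := by
    intro v h
    have h1 := hx4 (x v)
    have h2 := hx4 (y v)
    rw [Finset.insert_subset_iff, Finset.singleton_subset_iff]
    constructor
    · by_contra hS
      have := hxN hS
      omega
    · by_contra hS
      have := hxN hS
      omega
  have hcases : S.card = 0 ∨ S.card = 1 ∨ S.card = 2 ∨ S.card = 3 ∨ (4 ≤ S.card ∧ S.card ≤ 5) ∨
      6 ≤ S.card := by omega
  rcases hcases with h0 | h1 | h2 | h3 | h45 | h6
  · have hS : ∀ v, v ∉ S := by simp [Finset.card_eq_zero.1 h0]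
    obtain ⟨v⟩ : Nonempty V := Fintype.card_pos_iff.1 (by omega)
    have hn3 := hany v
    have hx1 := hxN (hS (x v))
    have hy1 := hxN (hS (y v))
    have := card_le_card_add_of_label_injOn (S := S) (p := p) fun u w hu hw huw => by
      by_contra hne
      have := htwin u w hu hw huw hne
      have := hxN (hS (x u))
      have := hxN (hS (y u))
      omega
    omega
  · obtain ⟨a, rfl⟩ := Finset.card_eq_one.1 h1
    have := hmem a (by simp)
    have := hxN (a := x a) (by simpa using hne_x a)
    have := hxN (a := y a) (by simpa using hne_y a)
    omega
  · obtain ⟨a, b, -, rfl⟩ := Finset.card_eq_two.1 h2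
    have hadj : ∀ a' b', ({a', b'} : Finset V) = {a, b} →
        ∃ k, ∀ v, v ∉ ({a, b} : Finset V) → p v ≠ k → G.Adj b' v := by
      intro a' b' hab
      have ha' : a' ∈ ({a, b} : Finset V) := by simp [← hab]
      have hz : ∀ z, z ≠ a' → z ∈ ({a, b} : Finset V) → z = b' := by
        intro z hz hzS
        rw [← hab] at hzS
        simpa [hz] using hzS
      have hreach : ∀ z v, z ≠ a' → v ∉ ({a, b} : Finset V) → p v ≠ p z →
          (v = z ∨ G.Adj z v) → G.Adj b' v := by
        rintro z v hza hv hpv (rfl | hzv)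
        · exact absurd rfl hpv
        · by_cases hzS : z ∈ ({a, b} : Finset V)
          · exact hz z hza hzS ▸ hzv
          · exact absurd (hp z v hzS hv hzv).symm hpv
      have hb' : ∀ v, v ∉ ({a, b} : Finset V) → (v = b' ∨ G.Adj b' v) → G.Adj b' v := by
        rintro v hv (rfl | h)
        · exact absurd (by simp [← hab]) hv
        · exact h
      have hin : x a' ∈ ({a, b} : Finset V) ∨ y a' ∈ ({a, b} : Finset V) := by
        by_contra! hout
        have := hmem a' ha'
        have := hxN hout.1
        have := hxN hout.2
        omega
      rcases hin with hin | hin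
      · refine ⟨p (y a'), fun v hv hpv => ?_⟩
        rcases hdom a' v (fun h => hv (h ▸ ha')) with h | h
        · rw [hz _ (hne_x a') hin] at h
          exact hb' v hv h
        · exact hreach _ v (hne_y a') hv hpv h
      · refine ⟨p (x a'), fun v hv hpv => ?_⟩
        rcases hdom a' v (fun h => hv (h ▸ ha')) with h | h
        · exact hreach _ v (hne_x a') hv hpv h
        · rw [hz _ (hne_y a') hin] at h
          exact hb' v hv h
    obtain ⟨k, hk⟩ := hadj a b rfl
    obtain ⟨l, hl⟩ := hadj b a (Finset.pair_comm b a)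
    obtain ⟨m, hm⟩ : ∃ m, m ∉ ({k, l} : Finset (Fin n)) := by
      by_contra! hall
      have h1 := Finset.card_le_card (fun m _ => hall m : Finset.univ ⊆ ({k, l} : Finset (Fin n)))
      have h2 := Finset.card_le_two (a := k) (b := l)
      simp only [Finset.card_univ, Fintype.card_fin] at h1
      omega
    simp only [Finset.mem_insert, Finset.mem_singleton, not_or] at hm
    obtain ⟨v, hv, rfl⟩ := hsurj m
    have hS : ∀ z ∈ ({a, b} : Finset V), G.Adj z v := by
      simp [hk v hv hm.1, hl v hv hm.2]
    have hxv : x v ∉ ({a, b} : Finset V) := fun h => hnot v (Or.inl (Or.inr (hS _ h)))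
    have hyv : y v ∉ ({a, b} : Finset V) := fun h => hnot v (Or.inr (Or.inr (hS _ h)))
    have := hany v
    have := hxN hxv
    have := hxN hyv
    omega
  · have hout : ∀ v, v ∉ S → ¬ ({x v, y v} : Finset V) ⊆ S := by
      intro v hv hsub
      obtain ⟨a, haS, ha⟩ := Finset.exists_mem_notMem_of_card_lt_card
        (s := ({x v, y v} : Finset V)) (t := S) (by rw [hcard_pair (by omega)]; omega)
      have hsub_a : ({x a, y a} : Finset V) ⊆ S := hpair_subset a (by
        have := hmem a haS
        omega)
      have heq : ∀ z, ({x z, y z} : Finset V) ⊆ S → a ∉ ({x z, y z} : Finset V) →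
          ({x z, y z} : Finset V) = S.erase a := by
        intro z hz haz
        refine Finset.eq_of_subset_of_card_le (Finset.subset_erase.2 ⟨hz, haz⟩) ?_
        rw [hcard_pair (by omega), Finset.card_erase_of_mem haS]
        omega
      have hva : v = a := hpair v a ((heq v hsub ha).trans (heq a hsub_a (by
        simp [(hne_x a).symm, (hne_y a).symm])).symm)
      exact hv (hva ▸ haS)
    have hsum : ∀ v, v ∉ S →
        (labelNeighbors G S p (x v)).card + (labelNeighbors G S p (y v)).card ≤ 5 := by
      intro v hv
      by_contra! h
      exact hout v hv (hpair_subset v h)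
    obtain ⟨v, hv, -⟩ := hsurj ⟨0, by omega⟩
    have := hany v
    have := hsum v hv
    have := card_le_card_add_of_label_injOn (S := S) (p := p) fun u w hu hw huw => by
      by_contra hne
      have := htwin u w hu hw huw hne
      have := hsum u hu
      omega
    omega
  · have hle : (Finset.univ : Finset V).card ≤ (S.powersetCard 2).card := by
      refine Finset.card_le_card_of_injOn (fun v => {x v, y v}) (fun v _ => ?_)
        fun v _ w _ h => hpair v w h
      refine Finset.mem_coe.2 (Finset.mem_powersetCard.2 ⟨hpair_subset v ?_, hcard_pair ?_ v⟩)
      · have := hany v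
        by_contra! h
        have := hx4 (x v)
        have := hx4 (y v)
        omega
      · omega
    rw [Finset.card_powersetCard, Finset.card_univ] at hle
    have := Nat.choose_le_choose 2 h45.2
    have : Nat.choose 5 2 = 10 := rfl
    omega
  · obtain ⟨v, hv⟩ : S.Nonempty := Finset.card_pos.1 (by omega)
    have := hmem v hv
    have := hx4 (x v)
    have := hx4 (y v)
    omega

end Labelling

/-- Ananchuen–Plummer: a `3`-`γ`-vertex-critical `K_{1,5}`-free graph of
odd order at least `11` has a near perfect matching. -/
theorem three_gamma_critical_K15_free_odd_nearPerfectMatching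
    {V : Type*} [Fintype V] (G : SimpleGraph V)
    (hcrit : GammaCritical G 3) (hodd : Odd (Fintype.card V))
    (h11 : 11 ≤ Fintype.card V) (hfree : StarFree G 5) :
    HasNearPerfectMatching G := by
  by_contra h
  obtain ⟨S, n, p, hp, hsurj, hn⟩ := exists_labelling_of_not_hasNearPerfectMatching hodd h
  exact hcrit.labelling_false h11 hfree hp hsurj hn
end

section
/- If G is a disconnected 3-γ-vertex-critical graph, then either G consists of three isolated vertices (G = 3K_1), or G is the disjoint union of a 2-γ-vertex-critical graph and a single isolated vertex. -/
open SimpleGraph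

theorem domNum_le {V : Type*} {G : SimpleGraph V} {D : Set V} (hD : IsDomSet G D) :
    domNum G ≤ D.ncard :=
  Nat.sInf_le ⟨D, hD, rfl⟩

theorem exists_isDomSet_ncard_eq_domNum {V : Type*} (G : SimpleGraph V) :
    ∃ D : Set V, IsDomSet G D ∧ D.ncard = domNum G :=
  Nat.sInf_mem (s := {n | ∃ D : Set V, IsDomSet G D ∧ D.ncard = n})
    ⟨_, Set.univ, fun v => Or.inl (Set.mem_univ v), rfl⟩

theorem domNumDel_le {V : Type*} {G : SimpleGraph V} {x : V} {D : Set V}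
    (hD : IsDomSetAvoiding G x D) : domNumDel G x ≤ D.ncard :=
  Nat.sInf_le ⟨D, hD, rfl⟩

theorem exists_isDomSetAvoiding_ncard_eq_domNumDel {V : Type*} (G : SimpleGraph V) (x : V) :
    ∃ D : Set V, IsDomSetAvoiding G x D ∧ D.ncard = domNumDel G x :=
  Nat.sInf_mem (s := {n | ∃ D : Set V, IsDomSetAvoiding G x D ∧ D.ncard = n})
    ⟨_, {x}ᶜ, ⟨by simp, fun _ hv => Or.inl hv⟩, rfl⟩

/-- If a union of components `S` contains a non-isolated vertex `a` and `G - a` has a dominating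
set with at most two vertices, then a single vertex outside `S` dominates the complement of `S`. -/
theorem exists_dominating_vertex_compl {V : Type*} [Finite V] {G : SimpleGraph V} {S : Set V}
    (hS : ∀ u v, G.Adj u v → (u ∈ S ↔ v ∈ S)) {a c : V} (ha : a ∈ S) (hac : G.Adj a c)
    (hdel : domNumDel G a < 3) (hne : Sᶜ.Nonempty) :
    ∃ q, ∀ v ∉ S, v = q ∨ G.Adj q v := by
  obtain ⟨D, ⟨-, hD⟩, hcard⟩ := exists_isDomSetAvoiding_ncard_eq_domNumDel G a
  have hcS : c ∈ S := (hS a c hac).1 ha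
  obtain ⟨p, hpD, hpS⟩ : ∃ p ∈ D, p ∈ S := by
    rcases hD c hac.ne' with h | ⟨u, hu, huc⟩
    · exact ⟨c, h, hcS⟩
    · exact ⟨u, hu, (hS u c huc).2 hcS⟩
  have hout : ∀ v ∉ S, ∃ q ∈ D, q ∉ S ∧ (v = q ∨ G.Adj q v) := by
    intro v hv
    rcases hD v (fun h => hv (h ▸ ha)) with h | ⟨u, hu, huv⟩
    · exact ⟨v, h, hv, Or.inl rfl⟩
    · exact ⟨u, hu, fun h => hv ((hS u v huv).1 h), Or.inr huv⟩
  obtain ⟨b, hb⟩ := hne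
  obtain ⟨q, hqD, hqS, -⟩ := hout b hb
  refine ⟨q, fun v hv => ?_⟩
  obtain ⟨r, hrD, hrS, hr⟩ := hout v hv
  have hrq : r = q := by
    by_contra hne
    have hthree : ({p, q, r} : Set V).ncard = 3 :=
      Set.ncard_eq_three.2 ⟨p, q, r, fun h => hqS (h ▸ hpS), fun h => hrS (h ▸ hpS),
        Ne.symm hne, rfl⟩
    have hle : ({p, q, r} : Set V).ncard ≤ D.ncard := by
      refine Set.ncard_le_ncard ?_ D.toFinite
      rintro x (rfl | rfl | rfl) <;> assumption
    omega
  exact hrq ▸ hr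

/-- A disconnected `3`-`γ`-vertex-critical graph has an isolated vertex. -/
theorem GammaCritical.exists_isolated {V : Type*} [Finite V] {G : SimpleGraph V}
    (hcrit : GammaCritical G 3) (hdisc : ¬ G.Connected) : ∃ v, ∀ w, ¬ G.Adj v w := by
  obtain ⟨hdom, hdel⟩ := hcrit
  by_contra! hiso
  have hV : Nonempty V := by
    by_contra hV
    rw [not_nonempty_iff] at hV
    have := domNum_le (G := G) (D := ∅) (fun v => isEmptyElim v)
    simp [hdom] at this
  obtain ⟨a, b, hab⟩ : ∃ a b, ¬ G.Reachable a b := by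
    by_contra! h
    exact hdisc ⟨h⟩
  have hS : ∀ u v, G.Adj u v → (u ∈ {w | G.Reachable a w} ↔ v ∈ {w | G.Reachable a w}) :=
    fun u v huv => ⟨fun h => h.trans huv.reachable, fun h => h.trans huv.symm.reachable⟩
  obtain ⟨c, hac⟩ := hiso a
  obtain ⟨d, hbd⟩ := hiso b
  obtain ⟨q, hq⟩ := exists_dominating_vertex_compl hS (Reachable.refl a) hac (hdel a) ⟨b, hab⟩
  obtain ⟨p, hp⟩ := exists_dominating_vertex_compl (S := {w | G.Reachable a w}ᶜ)
    (fun u v huv => not_congr (hS u v huv)) hab hbd (hdel b) ⟨a, fun h => h (Reachable.refl a)⟩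
  have hpq : IsDomSet G {p, q} := by
    intro v
    by_cases hv : v ∈ {w | G.Reachable a w}
    · rcases hp v (fun h => h hv) with h | h
      · exact Or.inl (Or.inl h)
      · exact Or.inr ⟨p, Or.inl rfl, h⟩
    · rcases hq v hv with h | h
      · exact Or.inl (Or.inr h)
      · exact Or.inr ⟨q, Or.inr rfl, h⟩
  have h1 := domNum_le hpq
  have h2 := Set.ncard_insert_le p {q}
  rw [Set.ncard_singleton] at h2
  omega

/-- Deleting an isolated vertex from a `(k + 1)`-`γ`-vertex-critical graph leaves a
`k`-`γ`-vertex-critical graph. -/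
theorem GammaCritical.induce_compl_isolated {V : Type*} [Finite V] {G : SimpleGraph V} {k : ℕ}
    (hcrit : GammaCritical G (k + 1)) {v : V} (hv : ∀ w, ¬ G.Adj v w) :
    GammaCritical (G.induce {v}ᶜ) k := by
  obtain ⟨hdom, hdel⟩ := hcrit
  have hdominate : ∀ (D : Set V) (w : ({v}ᶜ : Set V)),
      ((w : V) ∈ D ∨ ∃ u ∈ D, G.Adj u w) →
      w ∈ (Subtype.val ⁻¹' D : Set ({v}ᶜ : Set V)) ∨
        ∃ u ∈ (Subtype.val ⁻¹' D : Set ({v}ᶜ : Set V)), (G.induce {v}ᶜ).Adj u w := by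
    rintro D w (h | ⟨u, hu, huw⟩)
    · exact Or.inl h
    · exact Or.inr ⟨⟨u, fun h => hv w (h ▸ huw)⟩, hu, huw⟩
  have hncard : ∀ D : Set V,
      (Subtype.val ⁻¹' D : Set ({v}ᶜ : Set V)).ncard ≤ (D \ {v}).ncard := by
    intro D
    rw [← Set.ncard_image_of_injective _ Subtype.val_injective]
    refine Set.ncard_le_ncard ?_ (Set.toFinite _)
    rintro _ ⟨x, hx, rfl⟩
    exact ⟨hx, x.2⟩
  refine ⟨le_antisymm ?_ ?_, fun w => ?_⟩
  · obtain ⟨D, ⟨hvD, hD⟩, hcard⟩ := exists_isDomSetAvoiding_ncard_eq_domNumDel G v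
    have h1 := domNum_le (G := G.induce {v}ᶜ) (fun w => hdominate D w (hD w w.2))
    have h2 := hncard D
    rw [Set.sdiff_singleton_eq_self hvD] at h2
    have h3 := hdel v
    change domNum (G.induce {v}ᶜ) ≤ (Subtype.val ⁻¹' D : Set ({v}ᶜ : Set V)).ncard at h1
    omega
  · obtain ⟨E, hE, hcard⟩ := exists_isDomSet_ncard_eq_domNum (G.induce {v}ᶜ)
    have hins : IsDomSet G (insert v (Subtype.val '' E)) := by
      intro w
      by_cases hw : w = v
      · exact Or.inl (Or.inl hw)
      · rcases hE ⟨w, hw⟩ with h | ⟨u, hu, huw⟩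
        · exact Or.inl (Or.inr ⟨_, h, rfl⟩)
        · exact Or.inr ⟨u, Or.inr ⟨u, hu, rfl⟩, huw⟩
    have h1 := domNum_le hins
    have h2 := Set.ncard_insert_le v (Subtype.val '' E)
    rw [Set.ncard_image_of_injective _ Subtype.val_injective] at h2
    omega
  · obtain ⟨D, ⟨hwD, hD⟩, hcard⟩ := exists_isDomSetAvoiding_ncard_eq_domNumDel G (w : V)
    have hvD : v ∈ D := by
      rcases hD v (fun h => w.2 h.symm) with h | ⟨u, -, huv⟩
      · exact h
      · exact absurd huv.symm (hv u)
    have h1 := domNumDel_le (G := G.induce {v}ᶜ) (x := w) (D := Subtype.val ⁻¹' D)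
      ⟨hwD, fun x hx => hdominate D x (hD x (fun h => hx (Subtype.ext h)))⟩
    have h2 := hncard D
    have h3 := Set.ncard_sdiff_singleton_add_one hvD D.toFinite
    have h4 := hdel w
    omega

/-- a disconnected `3`-`γ`-vertex-critical graph is either `3K₁`
(three isolated vertices) or the disjoint union of a `2`-`γ`-vertex-critical graph
and a single isolated vertex. -/
theorem disconnected_three_gamma_critical_structure
    {V : Type*} [Fintype V] (G : SimpleGraph V)
    (hcrit : GammaCritical G 3) (hdisc : ¬ G.Connected) :
    (Fintype.card V = 3 ∧ G = ⊥) ∨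
      ∃ v : V, (∀ w, ¬ G.Adj v w) ∧ GammaCritical (G.induce {v}ᶜ) 2 := by
  obtain ⟨v, hv⟩ := hcrit.exists_isolated hdisc
  exact Or.inr ⟨v, hv, hcrit.induce_compl_isolated hv⟩
end

section
/- Let G be a 3-γ-vertex-critical graph with a vertex cut S of size 2. Then G − S has at most three connected components; moreover, if G − S has exactly three components, then at least one of them is a single vertex. -/
open SimpleGraph

/-- In a `3`-`γ`-vertex-critical graph, each `G - w` is dominated by two distinct vertices, neither of which
lies in the closed neighbourhood of `w`. -/
theorem GammaCritical.exists_pair_s9 {V : Type*} [Finite V] {G : SimpleGraph V}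
    (hG : GammaCritical G 3) (w : V) :
    ∃ p q, p ≠ q ∧ p ≠ w ∧ q ≠ w ∧ ¬ G.Adj p w ∧ ¬ G.Adj q w ∧
      ∀ z, z ≠ w → z = p ∨ z = q ∨ G.Adj p z ∨ G.Adj q z := by
  have three_le : ∀ D : Set V, IsDomSet G D → 3 ≤ D.ncard := fun D hD =>
    hG.1 ▸ Nat.sInf_le ⟨D, hD, rfl⟩
  obtain ⟨D, ⟨hwD, hD⟩, hcard⟩ : domNumDel G w ∈
      {n | ∃ D : Set V, IsDomSetAvoiding G w D ∧ D.ncard = n} :=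
    Nat.sInf_mem ⟨_, {w}ᶜ, ⟨by simp, fun v hv => Or.inl (by simpa using hv)⟩, rfl⟩
  have hlt := hG.2 w
  have hins : 3 ≤ (insert w D).ncard := three_le _ fun v => by
    by_cases hv : v = w
    · exact Or.inl (Or.inl hv)
    · rcases hD v hv with h | ⟨a, ha, hav⟩
      · exact Or.inl (Or.inr h)
      · exact Or.inr ⟨a, Or.inr ha, hav⟩
  rw [Set.ncard_insert_of_notMem hwD (Set.toFinite D)] at hins
  have hnadj : ∀ p ∈ D, ¬ G.Adj p w := fun p hp hpw => by
    have := three_le D fun v => by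
      by_cases hv : v = w
      · exact Or.inr ⟨p, hp, hv ▸ hpw⟩
      · exact hD v hv
    omega
  obtain ⟨p, q, hpq, rfl⟩ := Set.ncard_eq_two.mp (show D.ncard = 2 by omega)
  refine ⟨p, q, hpq, ?_, ?_, hnadj p (by simp), hnadj q (by simp), fun z hz => ?_⟩
  · rintro rfl; simp at hwD
  · rintro rfl; simp at hwD
  · have := hD z hz
    simp only [Set.mem_insert_iff, Set.mem_singleton_iff, exists_eq_or_imp, exists_eq_left] at this
    tauto

theorem exists_ne_ne_of_three_le_card {K : Type*} (hK : 3 ≤ Nat.card K) (a b : K) :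
    ∃ k, k ≠ a ∧ k ≠ b := by
  by_contra! h
  have huniv : (Set.univ : Set K) ⊆ {a, b} := fun k _ => by
    by_cases hk : k = a
    · exact Or.inl hk
    · exact Or.inr (h k hk)
  have h1 := Set.ncard_le_ncard huniv
  have h2 := Set.ncard_insert_le a {b}
  rw [Set.ncard_univ] at h1
  rw [Set.ncard_singleton] at h2
  omega

/-- If the vertices outside `{u, v}` are coloured with at least three colours, adjacent ones
alike, then `v` is adjacent to every vertex outside `{u, v}` whose colour differs from that of a
suitable vertex `x` not adjacent to `u`. -/
theorem GammaCritical.exists_adj_of_ne {V K : Type*} [Finite V] {G : SimpleGraph V}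
    (hG : GammaCritical G 3) {u v : V} {f : V → K} (hK : 3 ≤ Nat.card K)
    (hf : ∀ a b, a ≠ u → a ≠ v → b ≠ u → b ≠ v → G.Adj a b → f a = f b)
    (hsurj : ∀ k, ∃ a, a ≠ u ∧ a ≠ v ∧ f a = k) :
    ∃ x, x ≠ u ∧ x ≠ v ∧ ¬ G.Adj x u ∧ ∀ z, z ≠ u → z ≠ v → f z ≠ f x → G.Adj v z := by
  obtain ⟨p, q, hpq, hpu, hqu, hpa, hqa, hdom⟩ := hG.exists_pair_s9 u
  by_cases hp : p = v
  · have hq : q ≠ v := fun hq => hpq (hp.trans hq.symm)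
    exact ⟨q, hqu, hq, hqa, by grind⟩
  · by_cases hq : q = v
    · exact ⟨p, hpu, hp, hpa, by grind⟩
    · obtain ⟨k, hkp, hkq⟩ := exists_ne_ne_of_three_le_card hK (f p) (f q)
      obtain ⟨a, hau, hav, rfl⟩ := hsurj k
      grind

/-- A colouring of the vertices outside `{u, v}` with at least three colours, all of them used and
adjacent vertices alike, has exactly three colours, one of which is used only once. -/
theorem GammaCritical.card_le_three_and_exists_unique {V K : Type*} [Finite V]
    {G : SimpleGraph V} (hG : GammaCritical G 3) {u v : V} {f : V → K} (hK : 3 ≤ Nat.card K)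
    (hf : ∀ a b, a ≠ u → a ≠ v → b ≠ u → b ≠ v → G.Adj a b → f a = f b)
    (hsurj : ∀ k, ∃ a, a ≠ u ∧ a ≠ v ∧ f a = k) :
    Nat.card K ≤ 3 ∧ ∃ w, w ≠ u ∧ w ≠ v ∧ ∀ z, z ≠ u → z ≠ v → f z = f w → z = w := by
  obtain ⟨x, -, -, -, hx⟩ := hG.exists_adj_of_ne hK hf hsurj
  obtain ⟨y, hyv, hyu, hya, hy⟩ := hG.exists_adj_of_ne (u := v) (v := u) hK
    (fun a b h1 h2 h3 h4 => hf a b h2 h1 h4 h3)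
    (fun k => (hsurj k).imp fun a h => ⟨h.2.1, h.1, h.2.2⟩)
  have hxy : f y = f x := by
    by_contra h
    exact hya (hx y hyu hyv h).symm
  obtain ⟨k, hk, -⟩ := exists_ne_ne_of_three_le_card hK (f x) (f x)
  obtain ⟨w, hwu, hwv, rfl⟩ := hsurj k
  have huw : G.Adj u w := hy w hwv hwu (hxy ▸ hk)
  have hvw : G.Adj v w := hx w hwu hwv hk
  obtain ⟨p, q, -, hpw, hqw, hpa, hqa, hdom⟩ := hG.exists_pair_s9 w
  have hcol : ∀ z, z ≠ u → z ≠ v → z ≠ w → f z = f p ∨ f z = f q := by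
    intro z hzu hzv hzw
    have hpu : p ≠ u := by rintro rfl; exact hpa huw
    have hpv : p ≠ v := by rintro rfl; exact hpa hvw
    have hqu : q ≠ u := by rintro rfl; exact hqa huw
    have hqv : q ≠ v := by rintro rfl; exact hqa hvw
    rcases hdom z hzw with rfl | rfl | h | h
    · exact Or.inl rfl
    · exact Or.inr rfl
    · exact Or.inl (hf p z hpu hpv hzu hzv h).symm
    · exact Or.inr (hf q z hqu hqv hzu hzv h).symm
  constructor
  · have huniv : (Set.univ : Set K) ⊆ {f w, f p, f q} := fun k _ => by
      obtain ⟨a, hau, hav, rfl⟩ := hsurj k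
      by_cases haw : a = w
      · exact Or.inl (congrArg f haw)
      · exact Or.inr (hcol a hau hav haw)
    have h1 := Set.ncard_le_ncard huniv
    have h2 := Set.ncard_insert_le (f w) {f p, f q}
    have h3 := Set.ncard_insert_le (f p) {f q}
    rw [Set.ncard_univ] at h1
    rw [Set.ncard_singleton] at h3
    omega
  · obtain ⟨k, hkp, hkq⟩ := exists_ne_ne_of_three_le_card hK (f p) (f q)
    obtain ⟨a, hau, hav, rfl⟩ := hsurj k
    have haw : a = w := by
      by_contra h
      rcases hcol a hau hav h with h | h
      · exact hkp h
      · exact hkq h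
    subst haw
    refine ⟨a, hau, hav, fun z hzu hzv hz => ?_⟩
    by_contra h
    rcases hcol z hzu hzv h with h | h
    · exact hkp (hz ▸ h)
    · exact hkq (hz ▸ h)

/-- if a `3`-`γ`-vertex-critical graph `G` has a vertex cut `S` of size two,
then `G - S` has at most three components, and if it has exactly three components then
at least one of them is a singleton. -/
theorem three_gamma_critical_two_cut
    {V : Type*} [Fintype V] (G : SimpleGraph V)
    (hcrit : GammaCritical G 3) (S : Set V) (hS : S.ncard = 2)
    (hconn : G.Connected) (hcut : ¬ (G.induce Sᶜ).Connected) :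
    Nat.card (G.induce Sᶜ).ConnectedComponent ≤ 3 ∧
      (Nat.card (G.induce Sᶜ).ConnectedComponent = 3 →
        ∃ C : (G.induce Sᶜ).ConnectedComponent, C.supp.ncard = 1) := by
  classical
  rcases Nat.lt_or_ge (Nat.card (G.induce Sᶜ).ConnectedComponent) 3 with hlt | hge
  · exact ⟨hlt.le, fun h => absurd h hlt.ne⟩
  obtain ⟨u, v, -, rfl⟩ := Set.ncard_eq_two.mp hS
  have mem_compl {a : V} (hu : a ≠ u) (hv : a ≠ v) : a ∈ ({u, v} : Set V)ᶜ := by simp [hu, hv]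
  obtain ⟨C₀⟩ : Nonempty (G.induce ({u, v} : Set V)ᶜ).ConnectedComponent :=
    (Nat.card_pos_iff.mp (by omega)).1
  let f : V → (G.induce ({u, v} : Set V)ᶜ).ConnectedComponent := fun a =>
    if h : a ∈ ({u, v} : Set V)ᶜ then (G.induce _).connectedComponentMk ⟨a, h⟩ else C₀
  have f_eq (a : V) (h : a ∈ ({u, v} : Set V)ᶜ) :
      f a = (G.induce _).connectedComponentMk ⟨a, h⟩ := dif_pos h
  obtain ⟨hle, w, hwu, hwv, hw⟩ := hcrit.card_le_three_and_exists_unique (f := f) hge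
    (fun a b hau hav hbu hbv hab => by
      rw [f_eq a (mem_compl hau hav), f_eq b (mem_compl hbu hbv)]
      exact ConnectedComponent.sound (Adj.reachable hab))
    (fun C => by
      induction C using ConnectedComponent.ind with
      | _ a =>
        exact ⟨a, fun h => a.2 (Or.inl h), fun h => a.2 (Or.inr h), f_eq a a.2⟩)
  refine ⟨hle, fun _ => ⟨f w, Set.ncard_eq_one.mpr ⟨⟨w, mem_compl hwu hwv⟩, ?_⟩⟩⟩
  ext ⟨z, hz⟩
  rw [ConnectedComponent.mem_supp_iff, Set.mem_singleton_iff, Subtype.mk.injEq, ← f_eq z hz]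
  exact ⟨hw z (fun h => hz (Or.inl h)) (fun h => hz (Or.inr h)), fun h => h ▸ rfl⟩
end

section
/- Let G be a 3-γ-vertex-critical graph and S ⊆ V(G). Suppose that for every vertex u ∈ S there exists a dominating set of G − u of cardinality 2 which is contained in S. Then the induced subgraph G[S] contains no vertex of degree one. -/
open SimpleGraph

/-- Wang–Yu: let `G` be `3`-`γ`-vertex-critical and `S ⊆ V(G)` such that
for every `u ∈ S` some dominating set of `G - u` of cardinality two is contained in `S`.
Then the induced subgraph `G[S]` has no vertex of degree one. -/
theorem no_degree_one_vertex_in_induced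
    {V : Type*} [Fintype V] (G : SimpleGraph V)
    (hcrit : GammaCritical G 3) (S : Set V)
    (hdom : ∀ u ∈ S, ∃ D : Set V, IsDomSetAvoiding G u D ∧ D.ncard = 2 ∧ D ⊆ S) :
    ∀ v ∈ S, {u | u ∈ S ∧ G.Adj v u}.ncard ≠ 1 := by
  rintro v - hv
  obtain ⟨w, hw⟩ := Set.ncard_eq_one.mp hv
  have hwv : w ∈ S ∧ G.Adj v w := by
    have h : w ∈ {u | u ∈ S ∧ G.Adj v u} := hw ▸ Set.mem_singleton w
    exact h
  obtain ⟨D, ⟨hwD, hD⟩, hcard, hDS⟩ := hdom w hwv.1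
  have hvD : v ∈ D := by
    rcases hD v hwv.2.ne with h | ⟨u, hu, huv⟩
    · exact h
    · have h : u ∈ ({w} : Set V) := hw ▸ ⟨hDS hu, huv.symm⟩
      exact absurd (Set.mem_singleton_iff.mp h ▸ hu) hwD
  have hdomD : IsDomSet G D := by
    intro x
    by_cases hx : x = w
    · exact Or.inr ⟨v, hvD, hx ▸ hwv.2⟩
    · exact hD x hx
  have hle : domNum G ≤ 2 := Nat.sInf_le ⟨D, hdomD, hcard⟩
  have hthree := hcrit.1
  omega
end

section
/- Let G be a 3-γ-vertex-critical graph of even order with minimum degree at least three. Then G is 3-connected. -/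
open SimpleGraph

/-- Closed adjacency: `u` is `v` or a neighbor of `v`. -/
def Dominates {V : Type*} (G : SimpleGraph V) (u v : V) : Prop :=
  u = v ∨ G.Adj u v

lemma Dominates.rfl {V : Type*} {G : SimpleGraph V} (v : V) : Dominates G v v := Or.inl _root_.rfl

lemma Dominates.symm {V : Type*} {G : SimpleGraph V} {u v : V} (h : Dominates G u v) :
    Dominates G v u :=
  h.imp Eq.symm SimpleGraph.Adj.symm

/-- A set in which every vertex is the only one missed by some other vertex of the set
(so that it induces a complete graph minus a perfect matching) has even size. -/
lemma even_card_of_unique_nonneighbor {V : Type*} {G : SimpleGraph V} (s : Finset V)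
    (h : ∀ a ∈ s, ∃ c ∈ s, ¬ Dominates G c a ∧ ∀ u ∈ s, u ≠ a → Dominates G c u) :
    Even s.card := by
  choose! f hf hna hdom using h
  have hsum : ∑ _a ∈ s, (1 : ZMod 2) = 0 := by
    refine Finset.sum_involution (fun a _ => f a) (fun _ _ => by decide) ?_ hf ?_
    · intro a ha _ hfa
      exact hna a ha (Or.inl hfa)
    · intro a ha
      by_contra hne
      exact hna _ (hf a ha) (hdom a ha _ (hf _ (hf a ha)) hne).symm
  rw [Finset.sum_const, nsmul_one] at hsum
  exact (ZMod.natCast_eq_zero_iff_even).1 hsum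

/-- The vertices of `G` other than `x` and `y` split into `A` and `B` with no edge between them,
where `G` is `3`-`γ`-vertex-critical. -/
structure CriticalCut {V : Type*} (G : SimpleGraph V) (A B : Finset V) (x y : V) : Prop where
  not_dominates : ∀ p q, ∃ u, ¬ Dominates G p u ∧ ¬ Dominates G q u
  critical : ∀ v, ∃ p q, ¬ Dominates G p v ∧ ¬ Dominates G q v ∧
    ∀ u, u ≠ v → Dominates G p u ∨ Dominates G q u
  cover : ∀ v, v ∈ A ∨ v ∈ B ∨ v = x ∨ v = y
  left_notMem_A : x ∉ A
  right_notMem_A : y ∉ A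
  left_notMem_B : x ∉ B
  right_notMem_B : y ∉ B
  separated : ∀ a ∈ A, ∀ b ∈ B, ¬ Dominates G a b
  nontrivial_A : A.Nontrivial
  nontrivial_B : B.Nontrivial
  even_card : Even (A.card + B.card)

namespace CriticalCut

variable {V : Type*} {G : SimpleGraph V} {A B : Finset V} {x y : V}

lemma swap_sides (h : CriticalCut G A B x y) : CriticalCut G B A x y where
  not_dominates := h.not_dominates
  critical := h.critical
  cover v := by have := h.cover v; tauto
  left_notMem_A := h.left_notMem_B
  right_notMem_A := h.right_notMem_B
  left_notMem_B := h.left_notMem_A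
  right_notMem_B := h.right_notMem_A
  separated b hb a ha hd := h.separated a ha b hb hd.symm
  nontrivial_A := h.nontrivial_B
  nontrivial_B := h.nontrivial_A
  even_card := by rw [add_comm]; exact h.even_card

lemma swap_cut (h : CriticalCut G A B x y) : CriticalCut G A B y x where
  not_dominates := h.not_dominates
  critical := h.critical
  cover v := by have := h.cover v; tauto
  left_notMem_A := h.right_notMem_A
  right_notMem_A := h.left_notMem_A
  left_notMem_B := h.right_notMem_B
  right_notMem_B := h.left_notMem_B
  separated := h.separated
  nontrivial_A := h.nontrivial_A
  nontrivial_B := h.nontrivial_B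
  even_card := h.even_card

/-- Some vertex of the cut, or one vertex on each side, is used to dominate `G - v`. -/
lemma critical_cases (h : CriticalCut G A B x y) (v : V) :
    ∃ p q, ¬ Dominates G p v ∧ ¬ Dominates G q v ∧
      (∀ u, u ≠ v → Dominates G p u ∨ Dominates G q u) ∧
      (p = x ∨ p = y ∨ p ∈ A ∧ q ∈ B) := by
  obtain ⟨p, q, hp, hq, hd⟩ := h.critical v
  have hd' : ∀ u, u ≠ v → Dominates G q u ∨ Dominates G p u := fun u hu => (hd u hu).symm
  obtain ⟨a, ha, hav⟩ := h.nontrivial_A.exists_ne v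
  obtain ⟨b, hb, hbv⟩ := h.nontrivial_B.exists_ne v
  have hda := hd a hav
  have hdb := hd b hbv
  have hs := h.separated
  have hs' := h.swap_sides.separated
  rcases h.cover p with hpA | hpB | hpx | hpy
  · rcases h.cover q with hqA | hqB | hqx | hqy
    · exact absurd hdb (by simp [hs p hpA b hb, hs q hqA b hb])
    · exact ⟨p, q, hp, hq, hd, by tauto⟩
    · exact ⟨q, p, hq, hp, hd', by tauto⟩
    · exact ⟨q, p, hq, hp, hd', by tauto⟩
  · rcases h.cover q with hqA | hqB | hqx | hqy
    · exact ⟨q, p, hq, hp, hd', by tauto⟩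
    · exact absurd hda (by simp [hs' p hpB a ha, hs' q hqB a ha])
    · exact ⟨q, p, hq, hp, hd', by tauto⟩
    · exact ⟨q, p, hq, hp, hd', by tauto⟩
  · exact ⟨p, q, hp, hq, hd, by tauto⟩
  · exact ⟨p, q, hp, hq, hd, by tauto⟩

lemma left_dominates_of_right_dominates (h : CriticalCut G A B x y)
    (hy : ∀ b ∈ B, Dominates G y b) : ∀ b ∈ B, Dominates G x b := by
  obtain ⟨p, q, hp, hq, hd, hpq⟩ := h.critical_cases y
  intro b hb
  have := h.separated
  have := h.cover q
  have := hd b (by rintro rfl; exact h.right_notMem_B hb)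
  grind [Dominates.symm, Dominates.rfl]

/-- The neighbors of `x` in `A` form a set of even size when, for every `a ∈ A`, some pair
dominating `G - a` uses the cut and `A` has a vertex without neighbors in the cut. -/
lemma even_card_filter_left [DecidablePred (Dominates G x)] (h : CriticalCut G A B x y)
    {a₀ : V} (ha₀ : a₀ ∈ A) (hx₀ : ¬ Dominates G x a₀) (hy₀ : ¬ Dominates G y a₀)
    (hxy : ¬ Dominates G x y)
    (hA : ∀ a ∈ A, ∃ p q, ¬ Dominates G p a ∧ ¬ Dominates G q a ∧
      (∀ u, u ≠ a → Dominates G p u ∨ Dominates G q u) ∧ (p = x ∨ p = y)) :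
    Even (A.filter (Dominates G x)).card := by
  refine even_card_of_unique_nonneighbor (G := G) _ fun a ha => ?_
  obtain ⟨haA, hxa⟩ := Finset.mem_filter.1 ha
  have hdisj : ∀ u ∈ A, Dominates G x u → ¬ Dominates G y u := by
    intro u hu
    obtain ⟨p, q, hp, hq, hd, hpq⟩ := hA u hu
    grind
  obtain ⟨p, q, hp, hq, hd, hpq⟩ := hA a haA
  have hpy : p = y := by grind
  have hq₀ : Dominates G q a₀ := by grind
  have hqx : Dominates G q x := by
    have := h.left_notMem_A
    grind [Dominates.symm]
  have hqA : q ∈ A := by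
    have := h.cover q
    have := h.separated a₀ ha₀ q
    grind [Dominates.symm]
  exact ⟨q, Finset.mem_filter.2 ⟨hqA, hqx.symm⟩, hq, fun u hu hne => by grind⟩

/-- If the two cut vertices are not adjacent, neither of them can dominate a side. -/
lemma false_of_right_dominates (h : CriticalCut G A B x y) (hxy : ¬ Dominates G x y)
    (hy : ∀ b ∈ B, Dominates G y b) : False := by
  classical
  have hx := h.left_dominates_of_right_dominates hy
  have hyx : ¬ Dominates G y x := fun hd => hxy hd.symm
  have hs := h.separated
  have key : ∀ b ∈ B, ∃ a ∈ A, ∃ c ∈ B, ¬ Dominates G c b ∧ (∀ u ∈ B, u ≠ b → Dominates G c u) ∧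
      ∀ u ∈ A, Dominates G a u := by
    intro b hb
    obtain ⟨p, q, hp, hq, hd, hpq⟩ := h.critical_cases b
    have hpq' : p ∈ A ∧ q ∈ B := by grind
    refine ⟨p, hpq'.1, q, hpq'.2, hq, fun u hu hne => ?_, fun u hu => ?_⟩
    · grind
    · have := hd u
      have := hs u hu
      grind [Dominates.symm, Dominates.rfl]
  have hBeven : Even B.card := even_card_of_unique_nonneighbor B fun b hb => by
    obtain ⟨a, ha, c, hc, h1, h2, h3⟩ := key b hb
    exact ⟨c, hc, h1, h2⟩
  obtain ⟨b₁, hb₁⟩ := h.nontrivial_B.nonempty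
  obtain ⟨a₀, ha₀, -, -, -, -, ha₀A⟩ := key b₁ hb₁
  have hmiss : ¬ Dominates G x a₀ ∧ ¬ Dominates G y a₀ := by
    obtain ⟨u, hu⟩ := h.not_dominates a₀ x
    obtain ⟨w, hw⟩ := h.not_dominates a₀ y
    have := h.cover u
    have := h.cover w
    constructor <;> grind [Dominates.symm, Dominates.rfl]
  have hA : ∀ a ∈ A, ∃ p q, ¬ Dominates G p a ∧ ¬ Dominates G q a ∧
      (∀ u, u ≠ a → Dominates G p u ∨ Dominates G q u) ∧ (p = x ∨ p = y) := by
    intro a ha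
    obtain ⟨p, q, hp, hq, hd, hpq⟩ := h.critical_cases a
    refine ⟨p, q, hp, hq, hd, ?_⟩
    by_contra hcon
    have hpq' : p ∈ A ∧ q ∈ B := by tauto
    obtain ⟨-, -, c, hc, h1, h2, -⟩ := key q hpq'.2
    have := hs a ha
    have := hd c
    have := hs p hpq'.1 c hc
    grind [Dominates.symm, Dominates.rfl]
  have hdisj : ∀ u ∈ A, Dominates G x u → ¬ Dominates G y u := by
    intro u hu
    obtain ⟨p, q, hp, hq, hd, hpq⟩ := hA u hu
    grind
  have hunion : A = insert a₀ (A.filter (Dominates G x) ∪ A.filter (Dominates G y)) := by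
    ext u
    obtain ⟨p, q, hp, hq, hd, hpq⟩ := hA a₀ ha₀
    have := h.cover q
    have := hs u
    have := hd u
    simp only [Finset.mem_insert, Finset.mem_union, Finset.mem_filter]
    grind [Dominates.symm, Dominates.rfl]
  have hX := h.even_card_filter_left ha₀ hmiss.1 hmiss.2 hxy hA
  have hY := h.swap_cut.even_card_filter_left ha₀ hmiss.2 hmiss.1 hyx
    fun a ha => by simpa only [or_comm] using hA a ha
  have hcard : A.card = (A.filter (Dominates G x)).card + (A.filter (Dominates G y)).card + 1 := by
    conv_lhs => rw [hunion]
    rw [Finset.card_insert_of_notMem (by simp [hmiss]), Finset.card_union_of_disjoint]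
    rw [Finset.disjoint_left]
    simpa using fun u hu hxu _ => hdisj u hu hxu
  have heven := h.even_card
  grind

/-- Centers `a₁`, `a₂` of `A` seeing `y` and `x` respectively, and a center `b₀` of `B`, give the
two sides different parities. -/
lemma false_of_centers (h : CriticalCut G A B x y) {a₁ a₂ b₀ : V} (ha₁ : a₁ ∈ A) (ha₂ : a₂ ∈ A)
    (hb₀ : b₀ ∈ B) (h₁ : ∀ u ∈ A, Dominates G a₁ u) (h₂ : ∀ u ∈ A, Dominates G a₂ u)
    (h₀ : ∀ u ∈ B, Dominates G b₀ u) (h₁x : ¬ Dominates G a₁ x) (h₁y : Dominates G a₁ y)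
    (h₂x : Dominates G a₂ x) (h₂y : ¬ Dominates G a₂ y) : False := by
  classical
  have hs := h.separated
  have hs' := h.swap_sides.separated
  have hxA := h.left_notMem_A
  have hyA := h.right_notMem_A
  have h₀x : ¬ Dominates G b₀ x := by
    obtain ⟨u, hu⟩ := h.not_dominates a₁ b₀
    have := h.cover u
    grind
  have h₀y : ¬ Dominates G b₀ y := by
    obtain ⟨u, hu⟩ := h.not_dominates a₂ b₀
    have := h.cover u
    grind
  have hne : a₁ ≠ a₂ := by grind
  have hxdom : ∀ u ∈ A, u ≠ a₁ → Dominates G x u := by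
    obtain ⟨p, q, hp, hq, hd, hpq⟩ := h.critical_cases a₁
    have := h.cover q
    grind [Dominates.symm, Dominates.rfl]
  have hydom : ∀ u ∈ A, u ≠ a₂ → Dominates G y u := by
    obtain ⟨p, q, hp, hq, hd, hpq⟩ := h.critical_cases a₂
    have := h.cover q
    grind [Dominates.symm, Dominates.rfl]
  have hAeven : Even ((A.erase a₁).erase a₂).card := by
    refine even_card_of_unique_nonneighbor (G := G) _ fun a ha => ?_
    obtain ⟨p, q, hp, hq, hd, hpq⟩ := h.critical_cases a
    have hpq' : p ∈ A ∧ q ∈ B := by grind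
    exact ⟨p, by grind [Dominates.symm], hp, by grind⟩
  have hBeven : Even (B.erase b₀).card := by
    refine even_card_of_unique_nonneighbor (G := G) _ fun b hb => ?_
    obtain ⟨p, q, hp, hq, hd, hpq⟩ := h.critical_cases b
    have := h.cover q
    have hpq' : p ∈ A ∧ q ∈ B := by
      have := hd a₁
      have := hd a₂
      have := hd b₀
      grind [Dominates.symm, Dominates.rfl]
    exact ⟨q, by grind [Dominates.symm], hq, by grind⟩
  have hcA : ((A.erase a₁).erase a₂).card + 2 = A.card := by
    rw [← Finset.card_erase_add_one ha₁,
      ← Finset.card_erase_add_one (Finset.mem_erase.2 ⟨hne.symm, ha₂⟩)]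
  have hcB := Finset.card_erase_add_one hb₀
  have heven := h.even_card
  grind

lemma exists_centers (h : CriticalCut G A B x y) :
    ∃ p ∈ A, ∃ q ∈ B, (∀ u ∈ A, Dominates G p u) ∧ (∀ u ∈ B, Dominates G q u) ∧
      ¬ Dominates G p x ∧ ¬ Dominates G q x ∧ (x ≠ y → Dominates G p y ∨ Dominates G q y) := by
  have hs := h.separated
  have hs' := h.swap_sides.separated
  have hxA := h.left_notMem_A
  have hxB := h.left_notMem_B
  obtain ⟨p, q, hp, hq, hd, hpq⟩ := h.critical_cases x
  rcases hpq with rfl | rfl | hpq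
  · exact absurd (Dominates.rfl _) hp
  · have hxp : ¬ Dominates G x p := fun hd => hp hd.symm
    by_cases hqA : q ∈ B
    · exact (h.swap_sides.false_of_right_dominates hxp (by grind)).elim
    · have := h.cover q
      exact (h.false_of_right_dominates hxp (by grind [Dominates.rfl])).elim
  · exact ⟨p, hpq.1, q, hpq.2, by grind, by grind, hp, hq, by grind⟩

theorem false_of_ne (h : CriticalCut G A B x y) (hxy : x ≠ y) : False := by
  obtain ⟨p, hpA, q, hqB, hp, hq, hpx, hqx, hy⟩ := h.exists_centers
  obtain ⟨p', hpA', q', hqB', hp', hq', hpy', hqy', hx⟩ := h.swap_cut.exists_centers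
  have hpq : ¬ (Dominates G p y ∧ Dominates G q' x) := by
    obtain ⟨u, hu⟩ := h.not_dominates p q'
    have := h.cover u
    grind
  by_cases hpy : Dominates G p y
  · exact h.false_of_centers hpA hpA' hqB hp hp' hq hpx hpy (by grind) hpy'
  · by_cases hqx' : Dominates G q' x
    · exact h.swap_sides.false_of_centers hqB hqB' hpA hq hq' hp hqx (by grind) hqx' hqy'
    · obtain ⟨u, hu⟩ := h.not_dominates p' q
      have := h.cover u
      grind

end CriticalCut

lemma GammaCritical.not_dominates {V : Type*} {G : SimpleGraph V} (h : GammaCritical G 3)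
    (p q : V) : ∃ u, ¬ Dominates G p u ∧ ¬ Dominates G q u := by
  by_contra! hcon
  have hle : domNum G ≤ ({p, q} : Set V).ncard := by
    refine Nat.sInf_le ⟨{p, q}, fun v => ?_, _root_.rfl⟩
    have := hcon v
    simp only [Set.mem_insert_iff, Set.mem_singleton_iff, exists_eq_or_imp, exists_eq_left]
    unfold Dominates at this
    grind
  have := Set.ncard_insert_le p {q}
  rw [Set.ncard_singleton] at this
  have := h.1
  omega

lemma GammaCritical.exists_dominating_pair {V : Type*} [Finite V] [Nontrivial V]
    {G : SimpleGraph V} (h : GammaCritical G 3) (v : V) :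
    ∃ p q, ¬ Dominates G p v ∧ ¬ Dominates G q v ∧
      ∀ u, u ≠ v → Dominates G p u ∨ Dominates G q u := by
  obtain ⟨D, ⟨hvD, hD⟩, hcard⟩ : ∃ D, IsDomSetAvoiding G v D ∧ D.ncard = domNumDel G v :=
    Nat.sInf_mem (s := {n | ∃ D : Set V, IsDomSetAvoiding G v D ∧ D.ncard = n})
      ⟨_, {v}ᶜ, ⟨by simp, fun u hu => Or.inl hu⟩, _root_.rfl⟩
  have hlt := h.2 v
  obtain ⟨w, hw⟩ := exists_ne v
  have hne : D.Nonempty := by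
    rcases hD w hw with hwD | ⟨u, hu, -⟩
    exacts [⟨w, hwD⟩, ⟨u, hu⟩]
  obtain ⟨p, q, rfl⟩ : ∃ p q, D = {p, q} := by
    have hpos := (Set.ncard_pos (Set.toFinite D)).2 hne
    have : D.ncard = 1 ∨ D.ncard = 2 := by omega
    rcases this with h1 | h2
    · obtain ⟨p, rfl⟩ := Set.ncard_eq_one.1 h1
      exact ⟨p, p, by simp⟩
    · obtain ⟨p, q, -, rfl⟩ := Set.ncard_eq_two.1 h2
      exact ⟨p, q, _root_.rfl⟩
  have hdom : ∀ u, u ≠ v → Dominates G p u ∨ Dominates G q u := by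
    intro u hu
    have := hD u hu
    simp only [Set.mem_insert_iff, Set.mem_singleton_iff, exists_eq_or_imp,
      exists_eq_left] at this
    unfold Dominates
    grind
  obtain ⟨u, hpu, hqu⟩ := h.not_dominates p q
  have huv : u = v := by
    by_contra huv
    exact (hdom u huv).elim hpu hqu
  subst huv
  exact ⟨p, q, hpu, hqu, hdom⟩

/-- The closed neighborhood of a vertex of degree at least three has two vertices outside any
given set of two vertices. -/
lemma exists_ne_dominates_of_three_le_degree {V : Type*} [Finite V] {G : SimpleGraph V} (a : V)
    (hdeg : 3 ≤ (G.neighborSet a).ncard) {S : Set V} (hS : S.ncard = 2) :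
    ∃ u v, u ≠ v ∧ u ∉ S ∧ v ∉ S ∧ Dominates G a u ∧ Dominates G a v := by
  have hcard : (insert a (G.neighborSet a)).ncard = (G.neighborSet a).ncard + 1 :=
    Set.ncard_insert_of_notMem (by simp)
  have hdiff := Set.le_ncard_sdiff S (insert a (G.neighborSet a))
  obtain ⟨u, v, hu, hv, hne⟩ := (Set.one_lt_ncard_iff (Set.toFinite _)).1
    (show 1 < (insert a (G.neighborSet a) \ S).ncard by omega)
  refine ⟨u, v, hne, hu.2, hv.2, hu.1.imp Eq.symm id, hv.1.imp Eq.symm id⟩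

/-- Wang–Yu: a `3`-`γ`-vertex-critical graph of even order with minimum
degree at least three is `3`-connected: it has more than `3` vertices and deleting any
set of fewer than `3` vertices leaves it connected. -/
theorem three_gamma_critical_even_min_degree_three_connected
    {V : Type*} [Fintype V] (G : SimpleGraph V)
    (hcrit : GammaCritical G 3) (heven : Even (Fintype.card V))
    (hdeg : ∀ v : V, 3 ≤ (G.neighborSet v).ncard) :
    3 < Fintype.card V ∧ ∀ S : Set V, S.ncard < 3 → (G.induce Sᶜ).Connected := by
  classical
  have hpos : 0 < Fintype.card V := by
    by_contra hc
    have : IsEmpty V := Fintype.card_eq_zero_iff.1 (by omega)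
    have h0 : domNum G ≤ (∅ : Set V).ncard := Nat.sInf_le ⟨∅, fun v => isEmptyElim v, rfl⟩
    rw [Set.ncard_empty] at h0
    have := hcrit.1
    omega
  have hcard : 3 < Fintype.card V := by
    obtain ⟨a⟩ := Fintype.card_pos_iff.1 hpos
    have h1 : (insert a (G.neighborSet a)).ncard = (G.neighborSet a).ncard + 1 :=
      Set.ncard_insert_of_notMem (by simp)
    have h2 := Set.ncard_le_card (insert a (G.neighborSet a))
    rw [Nat.card_eq_fintype_card] at h2
    have := hdeg a
    omega
  refine ⟨hcard, fun S hS => ?_⟩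
  have : Nontrivial V := Fintype.one_lt_card_iff_nontrivial.1 (by omega)
  have hne : Nonempty ↥Sᶜ := by
    by_contra hemp
    have hS' : S = Set.univ := by
      simpa [Set.eq_univ_iff_forall] using hemp
    rw [hS', Set.ncard_univ, Nat.card_eq_fintype_card] at hS
    omega
  refine ⟨fun a b => ?_⟩
  by_contra hab
  obtain ⟨T, hST, -, hT⟩ := Set.exists_subsuperset_card_eq (Set.subset_univ S)
    (show S.ncard ≤ 2 by omega) (by rw [Set.ncard_univ, Nat.card_eq_fintype_card]; omega)
  obtain ⟨x, y, hxy, rfl⟩ := Set.ncard_eq_two.1 hT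
  let C : Set V := {v | ∃ hv : v ∈ Sᶜ, (G.induce Sᶜ).Reachable a ⟨v, hv⟩}
  have hC : ∀ u v, Dominates G u v → u ∉ S → v ∉ S → u ∈ C → v ∈ C := by
    rintro u v (rfl | huv) hu hv ⟨hu', hr⟩
    · exact ⟨hu', hr⟩
    · exact ⟨hv, hr.trans (SimpleGraph.Adj.reachable (by simpa using huv))⟩
  have haC : (a : V) ∈ C := ⟨a.2, .rfl⟩
  have hbC : (b : V) ∉ C := fun ⟨_, hr⟩ => hab hr
  let A : Finset V := {v | v ∈ C ∧ v ∉ ({x, y} : Set V)}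
  let B : Finset V := {v | v ∉ C ∧ v ∉ ({x, y} : Set V)}
  have hS' : ∀ v, v ∉ ({x, y} : Set V) → v ∉ S := fun v hv hvS => hv (hST hvS)
  have hcut : CriticalCut G A B x y :=
    { not_dominates := hcrit.not_dominates
      critical := hcrit.exists_dominating_pair
      cover := fun v => by simp [A, B]; tauto
      left_notMem_A := by simp [A]
      right_notMem_A := by simp [A]
      left_notMem_B := by simp [B]
      right_notMem_B := by simp [B]
      separated := fun u hu v hv hd => by
        obtain ⟨huC, huT⟩ := (Finset.mem_filter.1 hu).2
        obtain ⟨hvC, hvT⟩ := (Finset.mem_filter.1 hv).2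
        exact hvC (hC u v hd (hS' u huT) (hS' v hvT) huC)
      nontrivial_A := by
        obtain ⟨u, v, huv, hu, hv, hau, hav⟩ :=
          exists_ne_dominates_of_three_le_degree (a : V) (hdeg a) hT
        exact ⟨u, Finset.mem_filter.2 ⟨Finset.mem_univ _, hC _ u hau a.2 (hS' u hu) haC, hu⟩,
          v, Finset.mem_filter.2 ⟨Finset.mem_univ _, hC _ v hav a.2 (hS' v hv) haC, hv⟩, huv⟩
      nontrivial_B := by
        obtain ⟨u, v, huv, hu, hv, hbu, hbv⟩ :=
          exists_ne_dominates_of_three_le_degree (b : V) (hdeg b) hT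
        exact ⟨u, Finset.mem_filter.2 ⟨Finset.mem_univ _,
            fun hc => hbC (hC u _ hbu.symm (hS' u hu) b.2 hc), hu⟩,
          v, Finset.mem_filter.2 ⟨Finset.mem_univ _,
            fun hc => hbC (hC v _ hbv.symm (hS' v hv) b.2 hc), hv⟩, huv⟩
      even_card := by
        have hdisj : Disjoint A B := Finset.disjoint_filter.2 (by tauto)
        have hunion : A ∪ B = ({x, y} : Finset V)ᶜ := by
          ext v
          simp [A, B]
          tauto
        rw [← Finset.card_union_of_disjoint hdisj, hunion, Finset.card_compl,
          Finset.card_pair hxy]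
        exact heven.tsub even_two }
  exact hcut.false_of_ne hxy
end

section
/- Let G be a graph and m an integer with |V(G)| ≡ m (mod 2), and let S ⊆ V(G) satisfy c_o(G − S) ≥ |S| + m. If a vertex v ∈ S has neighbors in at most two odd components of G − S, then the set S' = S \ {v} also satisfies c_o(G − S') ≥ |S'| + m. Consequently, if S is minimal (with respect to inclusion) among sets satisfying c_o(G − S) ≥ |S| + m, then every vertex of S has neighbors in at least three odd components of G − S. -/
open SimpleGraph

/-- The number of odd components of `G - S` in which the vertex `v` has a neighbor. -/
noncomputable def numOddComponentsWithNeighbor {V : Type*} (G : SimpleGraph V)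
    (S : Set V) (v : V) : ℕ :=
  Nat.card {c : (G.induce Sᶜ).ConnectedComponent //
    Odd c.supp.ncard ∧ ∃ w ∈ c.supp, G.Adj v ↑w}

/-- If the image of a component under a graph homomorphism is closed under adjacency, then it is
the whole component containing it. -/
theorem SimpleGraph.ConnectedComponent.supp_map_eq_image {V W : Type*} {G : SimpleGraph V}
    {H : SimpleGraph W} (f : G →g H) (c : G.ConnectedComponent)
    (hc : ∀ x ∈ c.supp, ∀ y, H.Adj (f x) y → y ∈ f '' c.supp) :
    (c.map f).supp = f '' c.supp := by
  have closed : ∀ {a b : W}, H.Walk a b → a ∈ f '' c.supp → b ∈ f '' c.supp := by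
    intro a b p
    induction p with
    | nil => exact id
    | cons h _ ih =>
      rintro ⟨x, hx, rfl⟩
      exact ih (hc x hx _ h)
  ext y
  constructor
  · intro hy
    obtain ⟨x, rfl⟩ := c.exists_rep
    obtain ⟨p⟩ := ConnectedComponent.exact hy
    exact closed p.reverse ⟨x, rfl, rfl⟩
  · rintro ⟨x, hx, rfl⟩
    rw [ConnectedComponent.mem_supp_iff] at hx ⊢
    rw [← hx, ConnectedComponent.map_mk]

/-- Putting `v` back into `G - S` keeps every odd component in which `v` has no neighbor. -/
theorem numOddComponents_le_add_sdiff_singleton {V : Type*} [Finite V] (G : SimpleGraph V)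
    (S : Set V) (v : V) :
    numOddComponents G S ≤
      numOddComponentsWithNeighbor G S v + numOddComponents G (S \ {v}) := by
  let f : G.induce Sᶜ ↪g G.induce (S \ {v})ᶜ :=
    G.induceHomOfLE (Set.compl_subset_compl.2 Set.sdiff_subset)
  let A : Set (G.induce Sᶜ).ConnectedComponent := {c | Odd c.supp.ncard}
  let B : Set (G.induce Sᶜ).ConnectedComponent :=
    {c | Odd c.supp.ncard ∧ ∃ w ∈ c.supp, G.Adj v ↑w}
  have supp_map : ∀ c ∈ A \ B, (c.map f.toHom).supp = f '' c.supp := by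
    rintro c ⟨hodd, hB⟩
    refine c.supp_map_eq_image f.toHom fun x hx y hxy ↦ ?_
    have hadj : G.Adj x y := hxy
    have hyv : (y : V) ≠ v := fun h ↦ hB ⟨hodd, x, hx, h ▸ hadj.symm⟩
    have hyS : (y : V) ∈ Sᶜ := fun h ↦ y.2 ⟨h, hyv⟩
    exact ⟨⟨y, hyS⟩, c.mem_supp_of_adj_mem_supp hx hadj, rfl⟩
  have hle : (A \ B).ncard ≤ numOddComponents G (S \ {v}) := by
    refine Set.ncard_le_ncard_of_injOn (t := {c | Odd c.supp.ncard})
      (fun c : (G.induce Sᶜ).ConnectedComponent ↦ c.map f.toHom)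
      (fun c hc ↦ ?_) (fun c hc d hd h ↦ ?_)
    · change Odd (c.map f.toHom).supp.ncard
      rw [supp_map c hc, Set.ncard_image_of_injective _ f.injective]
      exact hc.1
    · have himage := congrArg ConnectedComponent.supp h
      dsimp only at himage
      rw [supp_map c hc, supp_map d hd] at himage
      exact ConnectedComponent.supp_injective (f.injective.image_injective himage)
  calc A.ncard ≤ (A \ B).ncard + B.ncard := Set.ncard_le_ncard_sdiff_add_ncard A B
    _ ≤ _ := by rw [add_comm]; exact Nat.add_le_add_left hle B.ncard

/-- The number of odd components of `G - S` has the same parity as `|V(G)| - |S|`. -/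
theorem numOddComponents_add_ncard_mod_two {V : Type*} [Fintype V] (G : SimpleGraph V)
    (S : Set V) : (numOddComponents G S + S.ncard) % 2 = Fintype.card V % 2 := by
  have hodd : Odd (numOddComponents G S) ↔ Odd Sᶜ.ncard :=
    odd_ncard_oddComponents (G.induce Sᶜ)
  have hcard := Set.ncard_add_ncard_compl S
  rw [Nat.card_eq_fintype_card] at hcard
  rw [Nat.odd_iff, Nat.odd_iff] at hodd
  omega

/-- if `|V(G)| ≡ m (mod 2)` and `S` satisfies `c_o(G - S) ≥ |S| + m`, then
(1) removing from `S` a vertex with neighbors in at most two odd components of `G - S`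
yields a set `S'` with `c_o(G - S') ≥ |S'| + m`; consequently (2) if `S` is minimal with
this property, every vertex of `S` has neighbors in at least three odd components. -/
theorem odd_components_minimal_cut_neighbors
    {V : Type*} [Fintype V] (G : SimpleGraph V) (m : ℕ) (S : Set V)
    (hpar : Fintype.card V % 2 = m % 2)
    (hS : S.ncard + m ≤ numOddComponents G S) :
    (∀ v ∈ S, numOddComponentsWithNeighbor G S v ≤ 2 →
      (S \ {v}).ncard + m ≤ numOddComponents G (S \ {v})) ∧
    ((∀ T : Set V, T ⊆ S → T.ncard + m ≤ numOddComponents G T → T = S) →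
      ∀ v ∈ S, 3 ≤ numOddComponentsWithNeighbor G S v) := by
  have step : ∀ v ∈ S, numOddComponentsWithNeighbor G S v ≤ 2 →
      (S \ {v}).ncard + m ≤ numOddComponents G (S \ {v}) := by
    intro v hv h
    have hle := numOddComponents_le_add_sdiff_singleton G S v
    have hmod := numOddComponents_add_ncard_mod_two G (S \ {v})
    have hcard := Set.ncard_sdiff_singleton_add_one hv
    omega
  refine ⟨step, fun hmin v hv ↦ ?_⟩
  by_contra! hlt
  have heq := hmin _ Set.sdiff_subset (step v hv (by omega))
  exact (heq.symm ▸ hv : v ∈ S \ {v}).2 rfl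
end

section
/- Let G be a 3-γ-vertex-critical graph and S ⊆ V(G) with |S| = 3. Suppose G − S has at least five odd components and every vertex of S has neighbors in at least three odd components of G − S. Then for every s ∈ S, every dominating set of G − s of cardinality 2 is contained in S. -/
open SimpleGraph

/-- A vertex-critical graph with `γ(G) = 3` has no dominating set of at most two vertices. -/
theorem GammaCritical.not_isDomSet {V : Type*} {G : SimpleGraph V} (h : GammaCritical G 3)
    {D : Set V} (hD : D.ncard ≤ 2) : ¬ IsDomSet G D := fun hdom => by
  have h3 : domNum G ≤ D.ncard := Nat.sInf_le ⟨D, hdom, rfl⟩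
  have := h.1
  omega

/-- A dominating set of `G - v` with at most two vertices contains no neighbor of `v`. -/
theorem GammaCritical.not_adj_of_isDomSetAvoiding {V : Type*} {G : SimpleGraph V}
    (h : GammaCritical G 3) {D : Set V} {v : V} (hD : IsDomSetAvoiding G v D)
    (hcard : D.ncard ≤ 2) {d : V} (hd : d ∈ D) : ¬ G.Adj d v := by
  intro hadj
  refine h.not_isDomSet hcard fun u => ?_
  by_cases huv : u = v
  · subst huv
    exact Or.inr ⟨d, hd, hadj⟩
  · exact hD.2 u huv

theorem GammaCritical.exists_isDomSetAvoiding {V : Type*} {G : SimpleGraph V}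
    (h : GammaCritical G 3) (v : V) : ∃ D : Set V, IsDomSetAvoiding G v D ∧ D.ncard ≤ 2 := by
  have hne : {n | ∃ D : Set V, IsDomSetAvoiding G v D ∧ D.ncard = n}.Nonempty :=
    ⟨_, {v}ᶜ, ⟨by simp, fun u hu => Or.inl hu⟩, rfl⟩
  obtain ⟨D, hD, hcard⟩ := Nat.sInf_mem hne
  have hlt : sInf {n | ∃ D : Set V, IsDomSetAvoiding G v D ∧ D.ncard = n} < 3 := h.2 v
  exact ⟨D, hD, by omega⟩

/-- A set of at most two vertices has no three distinct elements. -/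
theorem Set.eq_or_eq_or_eq_of_ncard_le_two {V : Type*} [Finite V] {D : Set V}
    (hD : D.ncard ≤ 2) {a b c : V} (ha : a ∈ D) (hb : b ∈ D) (hc : c ∈ D) :
    a = b ∨ a = c ∨ b = c := by
  by_contra! hne
  have := (Set.two_lt_ncard_iff (s := D) D.toFinite).2 ⟨a, b, c, ha, hb, hc, hne⟩
  omega

/-- The component of `G - S` containing a vertex outside `S`, and `none` for vertices of `S`. -/
noncomputable def componentOutside {V : Type*} (G : SimpleGraph V) (S : Set V) (v : V) :
    Option (G.induce Sᶜ).ConnectedComponent :=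
  open Classical in
  if h : v ∈ Sᶜ then some ((G.induce Sᶜ).connectedComponentMk ⟨v, h⟩) else none

theorem componentOutside_of_notMem {V : Type*} {G : SimpleGraph V} {S : Set V} {v : V}
    (h : v ∈ Sᶜ) :
    componentOutside G S v = some ((G.induce Sᶜ).connectedComponentMk ⟨v, h⟩) :=
  dif_pos h

theorem componentOutside_eq_of_adj {V : Type*} {G : SimpleGraph V} {S : Set V} {u v : V}
    (hu : u ∉ S) (hv : v ∉ S) (h : G.Adj u v) :
    componentOutside G S u = componentOutside G S v := by
  rw [componentOutside_of_notMem hu, componentOutside_of_notMem hv]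
  have : (G.induce Sᶜ).Adj ⟨u, hu⟩ ⟨v, hv⟩ := h
  exact congrArg some (ConnectedComponent.sound this.reachable)

/-- If every component of `G - S` satisfying `P` contains a vertex satisfying `Q`, and more than
`F.card` components satisfy `P`, then some vertex satisfying `Q` lies in a component not in `F`. -/
theorem exists_componentOutside_notMem {V : Type*} [Finite V] {G : SimpleGraph V} {S : Set V}
    {P : (G.induce Sᶜ).ConnectedComponent → Prop} {Q : V → Prop}
    (hPQ : ∀ c, P c → ∃ w ∈ c.supp, Q ↑w)
    (F : Finset (Option (G.induce Sᶜ).ConnectedComponent)) (hF : F.card < Nat.card {c // P c}) :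
    ∃ w, w ∉ S ∧ componentOutside G S w ∉ F ∧ Q w := by
  classical
  obtain ⟨c, hc⟩ : ∃ c : {c // P c}, some c.1 ∉ F := by
    by_contra! hall
    have := Nat.card_le_card_of_injective
      (fun c : {c // P c} => (⟨some c.1, hall c⟩ : {x // x ∈ F}))
      (fun c d hcd => Subtype.ext (by simpa using hcd))
    rw [Nat.card_eq_fintype_card (α := {x // x ∈ F}), Fintype.card_coe] at this
    omega
  obtain ⟨w, hw, hQ⟩ := hPQ c c.2
  refine ⟨w, w.2, ?_, hQ⟩
  rw [componentOutside_of_notMem w.2]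
  rw [ConnectedComponent.mem_supp_iff] at hw
  rwa [← hw] at hc

/-- A vertex outside `S` that is dominated by `D` but has no neighbor in `D ∩ S` lies in the
same component of `G - S` as some vertex of `D`. -/
theorem IsDomSetAvoiding.exists_componentOutside_eq {V : Type*} {G : SimpleGraph V} {S D : Set V}
    {v u : V} (hD : IsDomSetAvoiding G v D) (huv : u ≠ v) (hu : u ∉ S)
    (hS : ∀ d ∈ D, d ∈ S → ¬ G.Adj d u) :
    ∃ d ∈ D, d ∉ S ∧ componentOutside G S d = componentOutside G S u := by
  rcases hD.2 u huv with h | ⟨d, hd, hadj⟩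
  · exact ⟨u, h, hu, rfl⟩
  · have hdS : d ∉ S := fun hdS => hS d hd hdS hadj
    exact ⟨d, hd, hdS, componentOutside_eq_of_adj hdS hu hadj⟩

/-- A dominating set of `G - v` of at most two vertices meets `S`, provided that three
vertices other than `v` lie in distinct components of `G - S`. -/
theorem IsDomSetAvoiding.exists_mem_of_three_components {V : Type*} [Finite V]
    {G : SimpleGraph V} {S D : Set V} {v p q r : V} (hD : IsDomSetAvoiding G v D)
    (hcard : D.ncard ≤ 2)
    (hp : p ∉ S) (hq : q ∉ S) (hr : r ∉ S) (hpv : p ≠ v) (hqv : q ≠ v) (hrv : r ≠ v)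
    (hpq : componentOutside G S p ≠ componentOutside G S q)
    (hpr : componentOutside G S p ≠ componentOutside G S r)
    (hqr : componentOutside G S q ≠ componentOutside G S r) :
    ∃ d ∈ D, d ∈ S := by
  by_contra! hDS
  obtain ⟨d, hd, -, hdp⟩ := hD.exists_componentOutside_eq hpv hp fun d h h' => absurd h' (hDS d h)
  obtain ⟨e, he, -, heq⟩ := hD.exists_componentOutside_eq hqv hq fun d h h' => absurd h' (hDS d h)
  obtain ⟨f, hf, -, hfr⟩ := hD.exists_componentOutside_eq hrv hr fun d h h' => absurd h' (hDS d h)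
  rcases Set.eq_or_eq_or_eq_of_ncard_le_two hcard hd he hf with rfl | rfl | rfl
  · exact hpq (hdp.symm.trans heq)
  · exact hpr (hdp.symm.trans hfr)
  · exact hqr (heq.symm.trans hfr)

/-- let `G` be `3`-`γ`-vertex-critical and `S` a set of three vertices such
that `G - S` has at least five odd components and every vertex of `S` has neighbors in at
least three odd components of `G - S`. Then for every `s ∈ S`, every dominating set of
`G - s` of cardinality two is contained in `S`. -/
theorem three_cut_dominating_sets_inside
    {V : Type*} [Fintype V] (G : SimpleGraph V)
    (hcrit : GammaCritical G 3) (S : Set V) (hS : S.ncard = 3)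
    (hodd : 5 ≤ numOddComponents G S)
    (hadj : ∀ v ∈ S, 3 ≤ numOddComponentsWithNeighbor G S v) :
    ∀ s ∈ S, ∀ D : Set V, IsDomSetAvoiding G s D → D.ncard = 2 → D ⊆ S := by
  classical
  intro s hs D hD hDcard
  by_contra hDS
  obtain ⟨a, haD, haS⟩ := Set.not_subset.1 hDS
  have hDs {d : V} (hd : d ∈ D) : ¬ G.Adj d s :=
    hcrit.not_adj_of_isDomSetAvoiding hD hDcard.le hd
  have fresh (F : Finset (Option (G.induce Sᶜ).ConnectedComponent)) (hF : F.card ≤ 4) :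
      ∃ w, w ∉ S ∧ componentOutside G S w ∉ F := by
    obtain ⟨w, hw, hwF, -⟩ := exists_componentOutside_notMem (Q := fun _ => True)
      (fun c _ => ⟨_, c.nonempty_supp.some_mem, trivial⟩) F (hF.trans_lt hodd)
    exact ⟨w, hw, hwF⟩
  have hsne {u : V} (hu : u ∉ S) : u ≠ s := fun h => hu (h ▸ hs)
  obtain ⟨y, hyD, hyS⟩ : ∃ y ∈ D, y ∈ S := by
    obtain ⟨p, hp, -⟩ := fresh ∅ (by simp)
    obtain ⟨q, hq, hqF⟩ := fresh {componentOutside G S p} (by simp)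
    obtain ⟨r, hr, hrF⟩ := fresh {componentOutside G S p, componentOutside G S q}
      (Finset.card_le_two.trans (by norm_num))
    simp only [Finset.mem_insert, Finset.mem_singleton, not_or] at hqF hrF
    exact hD.exists_mem_of_three_components hDcard.le hp hq hr (hsne hp) (hsne hq) (hsne hr)
      (Ne.symm hqF) (Ne.symm hrF.1) (Ne.symm hrF.2)
  have hys : y ≠ s := fun h => hD.1 (h ▸ hyD)
  obtain ⟨z, hzS, hzs, hzy⟩ : ∃ z ∈ S, z ≠ s ∧ z ≠ y := by
    by_contra! hall
    have hsub : S ⊆ {s, y} := fun z hz => by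
      by_cases h : z = s
      · exact Or.inl h
      · exact Or.inr (hall z hz h)
    have := (Set.ncard_le_ncard hsub).trans_eq (Set.ncard_pair hys.symm)
    omega
  have hSeq {u : V} (hu : u ∈ S) : u = s ∨ u = y ∨ u = z := by
    by_contra! hne
    have hsub : ({u, s, y, z} : Set V) ⊆ S := by
      rintro w (rfl | rfl | rfl | rfl) <;> assumption
    have hcard := Set.ncard_le_ncard hsub
    rw [Set.ncard_insert_of_notMem (by simpa using hne),
      Set.ncard_insert_of_notMem (by simpa using ⟨hys.symm, hzs.symm⟩),
      Set.ncard_pair hzy.symm] at hcard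
    omega
  have hyadj {u : V} (hu : u ∉ S) (hua : componentOutside G S u ≠ componentOutside G S a) :
      G.Adj y u := by
    by_contra hnadj
    have hDeq {d : V} (hd : d ∈ D) : d = y ∨ d = a := by
      rcases Set.eq_or_eq_or_eq_of_ncard_le_two hDcard.le hd hyD haD with h | h | h
      exacts [Or.inl h, Or.inr h, absurd (h ▸ hyS) haS]
    obtain ⟨d, hd, hdS, hdu⟩ := hD.exists_componentOutside_eq (hsne hu) hu fun d hd hdS h => by
      rcases hDeq hd with rfl | rfl
      exacts [hnadj h, haS hdS]
    rcases hDeq hd with rfl | rfl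
    exacts [hdS hyS, hua hdu.symm]
  obtain ⟨v, hvS, hva, hzv⟩ := exists_componentOutside_notMem (Q := G.Adj z)
    (fun c hc => hc.2) {componentOutside G S a} (lt_of_lt_of_le (by simp) (hadj z hzS))
  rw [Finset.mem_singleton] at hva
  obtain ⟨p, hp, hpF⟩ := fresh {componentOutside G S a, componentOutside G S v}
    (Finset.card_le_two.trans (by norm_num))
  obtain ⟨q, hq, hqF⟩ := fresh {componentOutside G S a, componentOutside G S v,
    componentOutside G S p} (Finset.card_le_three.trans (by norm_num))
  obtain ⟨r, hr, hrF⟩ := fresh {componentOutside G S a, componentOutside G S v,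
    componentOutside G S p, componentOutside G S q} Finset.card_le_four
  simp only [Finset.mem_insert, Finset.mem_singleton, not_or] at hpF hqF hrF
  obtain ⟨hpa, hpv⟩ := hpF
  obtain ⟨hqa, hqv, hqp⟩ := hqF
  obtain ⟨hra, hrv, hrp, hrq⟩ := hrF
  have ne {u w : V} (h : componentOutside G S u ≠ componentOutside G S w) : u ≠ w :=
    fun h' => h (congrArg _ h')
  obtain ⟨E, hE, hEcard⟩ := hcrit.exists_isDomSetAvoiding v
  have hEv {d : V} (hd : d ∈ E) : ¬ G.Adj d v := hcrit.not_adj_of_isDomSetAvoiding hE hEcard hd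
  have hES {d : V} (hd : d ∈ E) (hdS : d ∈ S) : d = s := by
    rcases hSeq hdS with rfl | rfl | rfl
    exacts [rfl, absurd (hyadj hvS hva) (hEv hd), absurd hzv (hEv hd)]
  have hsE : s ∈ E := by
    obtain ⟨d, hd, hdS⟩ := hE.exists_mem_of_three_components hEcard hp hq hr
      (ne hpv) (ne hqv) (ne hrv) (Ne.symm hqp) (Ne.symm hrp) (Ne.symm hrq)
    exact hES hd hdS ▸ hd
  obtain ⟨w, hwE, hwS, hwa⟩ := hE.exists_componentOutside_eq (ne (Ne.symm hva)) haS
    fun d hd hdS h => hDs haD (hES hd hdS ▸ h).symm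
  have hsadj {u : V} (hu : u ∉ S) (hua : componentOutside G S u ≠ componentOutside G S a)
      (huv : componentOutside G S u ≠ componentOutside G S v) : G.Adj s u := by
    by_contra hnadj
    obtain ⟨d, hd, hdS, hdu⟩ := hE.exists_componentOutside_eq (ne huv) hu
      fun d hd hdS h => hnadj (hES hd hdS ▸ h)
    rcases Set.eq_or_eq_or_eq_of_ncard_le_two hEcard hd hsE hwE with rfl | rfl | rfl
    exacts [hdS hs, hua (hdu.symm.trans hwa), hwS hs]
  have hDz {u F} (hu : u ∉ S) (hua : componentOutside G S u ≠ componentOutside G S a)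
      (huv : componentOutside G S u ≠ componentOutside G S v) (hF : IsDomSetAvoiding G u F)
      (hFcard : F.ncard ≤ 2) {d : V} (hd : d ∈ F) (hdS : d ∈ S) : d = z := by
    have hnadj := hcrit.not_adj_of_isDomSetAvoiding hF hFcard hd
    rcases hSeq hdS with rfl | rfl | rfl
    exacts [absurd (hsadj hu hua huv) hnadj, absurd (hyadj hu hua) hnadj, rfl]
  have exists_avoiding {u u₁ u₂ : V} (hu : u ∉ S) (hu₁ : u₁ ∉ S) (hu₂ : u₂ ∉ S)
      (hua : componentOutside G S u ≠ componentOutside G S a)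
      (huv : componentOutside G S u ≠ componentOutside G S v)
      (hu₁v : componentOutside G S u₁ ≠ componentOutside G S v)
      (hu₂v : componentOutside G S u₂ ≠ componentOutside G S v)
      (h₁ : componentOutside G S u₁ ≠ componentOutside G S u)
      (h₂ : componentOutside G S u₂ ≠ componentOutside G S u)
      (h₁₂ : componentOutside G S u₁ ≠ componentOutside G S u₂) :
      ∃ F, IsDomSetAvoiding G u F ∧ F.ncard ≤ 2 ∧ z ∈ F ∧ ¬ G.Adj z u := by
    obtain ⟨F, hF, hFcard⟩ := hcrit.exists_isDomSetAvoiding u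
    obtain ⟨d, hd, hdS⟩ := hF.exists_mem_of_three_components hFcard hvS hu₁ hu₂
      (ne (Ne.symm huv)) (ne h₁) (ne h₂) (Ne.symm hu₁v) (Ne.symm hu₂v) h₁₂
    have hzF := hDz hu hua huv hF hFcard hd hdS ▸ hd
    exact ⟨F, hF, hFcard, hzF, hcrit.not_adj_of_isDomSetAvoiding hF hFcard hzF⟩
  obtain ⟨F, hF, hFcard, hzF, -⟩ := exists_avoiding hp hq hr hpa hpv hqv hrv hqp hrp (Ne.symm hrq)
  obtain ⟨-, -, -, -, hzq⟩ :=
    exists_avoiding hq hp hr hqa hqv hpv hrv (Ne.symm hqp) hrq (Ne.symm hrp)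
  obtain ⟨-, -, -, -, hzr⟩ :=
    exists_avoiding hr hp hq hra hrv hpv hqv (Ne.symm hrp) (Ne.symm hrq) (Ne.symm hqp)
  obtain ⟨d, hd, hdS, hdq⟩ := hF.exists_componentOutside_eq (ne hqp) hq
    fun d hd hdS h => hzq (hDz hp hpa hpv hF hFcard hd hdS ▸ h)
  obtain ⟨e, he, heS, her⟩ := hF.exists_componentOutside_eq (ne hrp) hr
    fun d hd hdS h => hzr (hDz hp hpa hpv hF hFcard hd hdS ▸ h)
  rcases Set.eq_or_eq_or_eq_of_ncard_le_two hFcard hd he hzF with rfl | rfl | rfl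
  exacts [hrq (her.symm.trans hdq), hdS hzS, heS hzS]
end

section
/- Let k ≥ 2, let G be a 3-γ-vertex-critical graph that is K_{1,k}-free, and let S ⊆ V(G) be a set such that G − S has at least k + 1 odd components. Then for every s ∈ S, every dominating set of G − s of cardinality 2 is contained in S. -/
open SimpleGraph

/-- The chosen representative of a component of `G - S`, as a vertex of `G`. -/
noncomputable def componentRep {V : Type*} {G : SimpleGraph V} {S : Set V}
    (c : (G.induce Sᶜ).ConnectedComponent) : V :=
  (Quot.out c : (Sᶜ : Set V)).1

theorem componentRep_notMem {V : Type*} {G : SimpleGraph V} {S : Set V}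
    (c : (G.induce Sᶜ).ConnectedComponent) : componentRep c ∉ S :=
  (Quot.out c : (Sᶜ : Set V)).2

theorem connectedComponentMk_componentRep {V : Type*} {G : SimpleGraph V} {S : Set V}
    (c : (G.induce Sᶜ).ConnectedComponent) :
    (G.induce Sᶜ).connectedComponentMk ⟨componentRep c, componentRep_notMem c⟩ = c :=
  Quot.out_eq c

theorem componentRep_injective {V : Type*} {G : SimpleGraph V} {S : Set V} :
    Function.Injective (componentRep : (G.induce Sᶜ).ConnectedComponent → V) := by
  intro c c' h
  rw [← connectedComponentMk_componentRep c, ← connectedComponentMk_componentRep c']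
  simp only [h]

/-- A vertex outside `S` equal or adjacent to the representative of a component of `G - S` lies in
that component. -/
theorem connectedComponentMk_eq_of_eq_or_adj_componentRep {V : Type*} {G : SimpleGraph V}
    {S : Set V} {a : V} (ha : a ∉ S) (c : (G.induce Sᶜ).ConnectedComponent)
    (h : componentRep c = a ∨ G.Adj a (componentRep c)) :
    (G.induce Sᶜ).connectedComponentMk ⟨a, ha⟩ = c := by
  conv_rhs => rw [← connectedComponentMk_componentRep c]
  rcases h with rfl | h
  · rfl
  · refine ConnectedComponent.connectedComponentMk_eq_of_adj ?_
    exact h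

theorem not_adj_componentRep {V : Type*} {G : SimpleGraph V} {S : Set V}
    {c c' : (G.induce Sᶜ).ConnectedComponent} (hne : c ≠ c') :
    ¬ G.Adj (componentRep c) (componentRep c') := fun h =>
  hne <| (connectedComponentMk_componentRep c).symm.trans <|
    connectedComponentMk_eq_of_eq_or_adj_componentRep (componentRep_notMem c) c' (Or.inr h)

/-- let `k ≥ 2`, let `G` be `3`-`γ`-vertex-critical and `K_{1,k}`-free, and
let `S` be a vertex set such that `G - S` has at least `k + 1` odd components. Then for
every `s ∈ S`, every dominating set of `G - s` of cardinality two is contained in `S`. -/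
theorem starFree_many_odd_components_domsets_inside_of_mem
    {V : Type*} [Fintype V] (G : SimpleGraph V) (k : ℕ) (hk : 2 ≤ k)
    (hcrit : GammaCritical G 3) (hfree : StarFree G k) (S : Set V)
    (hodd : k + 1 ≤ numOddComponents G S) :
    ∀ s ∈ S, ∀ D : Set V, IsDomSetAvoiding G s D → D.ncard = 2 → D ⊆ S := by
  classical
  intro s hs D hD hcard a haD
  by_contra ha
  obtain ⟨b, hb⟩ : ∃ b, D ⊆ {a, b} := by
    obtain ⟨x, y, -, rfl⟩ := Set.ncard_eq_two.mp hcard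
    rcases haD with rfl | rfl
    · exact ⟨y, subset_rfl⟩
    · exact ⟨x, (Set.pair_comm _ _).subset⟩
  let A := (G.induce Sᶜ).connectedComponentMk ⟨a, ha⟩
  have hcards : k + 1 ≤ (Finset.univ : Finset (G.induce Sᶜ).ConnectedComponent).card := by
    rw [Finset.card_univ, ← Nat.card_eq_fintype_card]
    exact hodd.trans (Finite.card_subtype_le _)
  have hbdom : ∀ c ≠ A, componentRep c = b ∨ G.Adj b (componentRep c) := by
    intro c hc
    have hna := mt (connectedComponentMk_eq_of_eq_or_adj_componentRep ha c) hc.symm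
    have hdom := hD.2 (componentRep c) fun h => componentRep_notMem c (h ▸ hs)
    rcases hdom with h | ⟨u, hu, h⟩
    · rcases hb h with h | h
      · exact absurd (Or.inl h) hna
      · exact Or.inl h
    · rcases hb hu with rfl | rfl
      · exact absurd (Or.inr h) hna
      · exact Or.inr h
  by_cases hbS : b ∈ S
  · obtain ⟨U, hU, hUcard⟩ := Finset.exists_subset_card_eq
      (s := Finset.univ.erase A) (n := k) (by
        rw [Finset.card_erase_of_mem (Finset.mem_univ A)]; omega)
    refine hfree ⟨b, U.image componentRep, ?_, ?_, ?_⟩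
    · rw [Finset.card_image_of_injective _ componentRep_injective, hUcard]
    · simp only [Finset.forall_mem_image]
      intro c hc
      refine (hbdom c (Finset.ne_of_mem_erase (hU hc))).resolve_left ?_
      rintro rfl
      exact componentRep_notMem c hbS
    · simp only [Finset.forall_mem_image]
      intro c _ c' _ hne
      exact not_adj_componentRep fun h => hne (congrArg componentRep h)
  · obtain ⟨c, -, hc⟩ := Finset.exists_mem_notMem_of_card_lt_card
      (s := {A, (G.induce Sᶜ).connectedComponentMk ⟨b, hbS⟩}) (t := Finset.univ)
      (Finset.card_le_two.trans_lt (by omega))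
    simp only [Finset.mem_insert, Finset.mem_singleton, not_or] at hc
    exact hc.2 (connectedComponentMk_eq_of_eq_or_adj_componentRep hbS c (hbdom c hc.1)).symm
end
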